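/- arXiv:2004.02265 — 7 statements merged into one kernel-verified Lean document; each statement's English description precedes it below -/
import Mathlib

section
/- For every integer a and every y in ℚ_p, the integral of the character over the ball B_a satisfies: ∫_{B_a} χ(x·y) dμ(x) = p^a if |y| ≤ p^{-a}, and ∫_{B_a} χ(x·y) dμ(x) = 0 if |y| > p^{-a}. -/
open MeasureTheory

section PadicIntegral

variable {p : ℕ} [hp : Fact p.Prime]

/-- Every `p`-adic number is within distance `1` of a rational in `[0, 1)` with denominator a power
of `p`. -/
theorem Padic.exists_fractionalPart (x : ℚ_[p]) :
    ∃ r : ℚ, (∃ (m : ℤ) (k : ℕ), r = (m : ℚ) / (p : ℚ) ^ k) ∧ 0 ≤ r ∧ r < 1 ∧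
      ‖x - (r : ℚ_[p])‖ ≤ 1 := by
  have hp0 : (0 : ℝ) < p := mod_cast hp.out.pos
  have hp1 : (1 : ℝ) < p := mod_cast hp.out.one_lt
  obtain ⟨k, hk⟩ := pow_unbounded_of_one_lt ‖x‖ hp1
  have hxk : ‖x * (p : ℚ_[p]) ^ k‖ ≤ 1 := by
    rw [norm_mul, norm_pow, Padic.norm_p, inv_pow, ← div_eq_mul_inv, div_le_one (by positivity)]
    exact hk.le
  set z : ℤ_[p] := ⟨x * (p : ℚ_[p]) ^ k, hxk⟩
  have hz : ‖x * (p : ℚ_[p]) ^ k - (z.appr k : ℚ_[p])‖ ≤ (p : ℝ) ^ (-k : ℤ) :=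
    (PadicInt.norm_le_pow_iff_mem_span_pow _ k).2 (PadicInt.appr_spec k z)
  have hpq : (0 : ℚ) < (p : ℚ) ^ k := pow_pos (mod_cast hp.out.pos) k
  refine ⟨(z.appr k : ℚ) / (p : ℚ) ^ k, ⟨z.appr k, k, by simp⟩, by positivity, ?_, ?_⟩
  · rw [div_lt_one hpq]
    exact_mod_cast z.appr_lt k
  · have hpk : ((p : ℚ_[p]) ^ k) ≠ 0 := pow_ne_zero _ (mod_cast hp.out.ne_zero)
    have h : x - (((z.appr k : ℚ) / (p : ℚ) ^ k : ℚ) : ℚ_[p]) =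
        (x * (p : ℚ_[p]) ^ k - (z.appr k : ℚ_[p])) / (p : ℚ_[p]) ^ k := by
      push_cast
      field_simp
    rw [h, norm_div, Padic.norm_p_pow]
    exact div_le_one_of_le₀ hz (by positivity)

/-- The ball of radius `p ^ (a + 1)` is the disjoint union of `p` translates of the ball of radius
`p ^ a`. -/
theorem Padic.closedBall_zpow_add_one (a : ℤ) :
    Metric.closedBall (0 : ℚ_[p]) ((p : ℝ) ^ (a + 1)) =
      ⋃ j ∈ Finset.range p,
        Metric.closedBall ((j : ℚ_[p]) * (p : ℚ_[p]) ^ (-(a + 1))) ((p : ℝ) ^ a) := by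
  have hp0 : (0 : ℝ) < p := mod_cast hp.out.pos
  have hp1 : (1 : ℝ) ≤ p := mod_cast hp.out.one_lt.le
  have hpp : (p : ℚ_[p]) ≠ 0 := mod_cast hp.out.ne_zero
  ext x
  simp only [Set.mem_iUnion, Finset.mem_range, mem_closedBall_iff_norm, sub_zero, exists_prop]
  constructor
  · intro hx
    have hxk : ‖x * (p : ℚ_[p]) ^ (a + 1)‖ ≤ 1 := by
      rw [norm_mul, Padic.norm_p_zpow, zpow_neg, ← div_eq_mul_inv]
      exact div_le_one_of_le₀ hx (by positivity)
    set z : ℤ_[p] := ⟨x * (p : ℚ_[p]) ^ (a + 1), hxk⟩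
    have hz : ‖x * (p : ℚ_[p]) ^ (a + 1) - (z.appr 1 : ℚ_[p])‖ ≤ (p : ℝ) ^ (-(1 : ℕ) : ℤ) :=
      (PadicInt.norm_le_pow_iff_mem_span_pow _ 1).2 (PadicInt.appr_spec 1 z)
    refine ⟨z.appr 1, by simpa using z.appr_lt 1, ?_⟩
    have h : x - (z.appr 1 : ℚ_[p]) * (p : ℚ_[p]) ^ (-(a + 1)) =
        (x * (p : ℚ_[p]) ^ (a + 1) - (z.appr 1 : ℚ_[p])) * (p : ℚ_[p]) ^ (-(a + 1)) := by
      rw [sub_mul, mul_assoc, ← zpow_add₀ hpp, add_neg_cancel, zpow_zero, mul_one]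
    rw [h, norm_mul, Padic.norm_p_zpow, neg_neg]
    calc _ ≤ (p : ℝ) ^ (-(1 : ℕ) : ℤ) * (p : ℝ) ^ (a + 1) := by gcongr
      _ = (p : ℝ) ^ a := by rw [← zpow_add₀ hp0.ne']; congr 1; push_cast; ring
  · rintro ⟨j, -, hx⟩
    rw [← sub_add_cancel x ((j : ℚ_[p]) * (p : ℚ_[p]) ^ (-(a + 1)))]
    refine (Padic.nonarchimedean _ _).trans (max_le (hx.trans ?_) ?_)
    · exact zpow_le_zpow_right₀ hp1 (by lia)
    · rw [norm_mul, Padic.norm_p_zpow, neg_neg]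
      exact mul_le_of_le_one_left (by positivity) (mod_cast Padic.norm_int_le_one (j : ℤ))

theorem Padic.pairwiseDisjoint_closedBall_zpow (a : ℤ) :
    Set.PairwiseDisjoint (Finset.range p : Set ℕ) fun j : ℕ ↦
      Metric.closedBall ((j : ℚ_[p]) * (p : ℚ_[p]) ^ (-(a + 1))) ((p : ℝ) ^ a) := by
  have hp0 : (0 : ℝ) < p := mod_cast hp.out.pos
  intro i hi j hj hij
  simp only [Finset.coe_range, Set.mem_Iio] at hi hj
  refine Set.disjoint_left.2 fun x hxi hxj ↦ hij ?_
  rw [mem_closedBall_iff_norm'] at hxi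
  rw [mem_closedBall_iff_norm] at hxj
  have h := (Padic.nonarchimedean _ _).trans (max_le hxi hxj)
  rw [sub_add_sub_cancel, ← sub_mul, norm_mul, Padic.norm_p_zpow, neg_neg,
    zpow_add_one₀ hp0.ne'] at h
  have h1 : ‖(((i : ℤ) - (j : ℤ) : ℤ) : ℚ_[p])‖ ≤ (p : ℝ) ^ (-(1 : ℕ) : ℤ) := by
    push_cast
    rw [zpow_neg_one, ← one_div, le_div_iff₀ hp0]
    have hpa : (0 : ℝ) < (p : ℝ) ^ a := by positivity
    refine le_of_mul_le_mul_right ?_ hpa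
    linarith
  rw [Padic.norm_int_le_pow_iff_dvd, pow_one] at h1
  have := Int.eq_zero_of_abs_lt_dvd h1 (by rw [abs_lt]; constructor <;> lia)
  lia

/-- The Haar measure normalised by `μ(ℤ_p) = 1` gives the ball of radius `p ^ a` measure
`p ^ a`. -/
theorem Padic.measureReal_closedBall_zpow [MeasurableSpace ℚ_[p]] [BorelSpace ℚ_[p]]
    (μ : Measure ℚ_[p]) [μ.IsAddHaarMeasure] (hμ : μ (Metric.closedBall 0 1) = 1) (a : ℤ) :
    μ.real (Metric.closedBall (0 : ℚ_[p]) ((p : ℝ) ^ a)) = (p : ℝ) ^ a := by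
  have hp0 : (p : ℝ) ≠ 0 := mod_cast hp.out.ne_zero
  have step (a : ℤ) : μ.real (Metric.closedBall (0 : ℚ_[p]) ((p : ℝ) ^ (a + 1))) =
      p * μ.real (Metric.closedBall (0 : ℚ_[p]) ((p : ℝ) ^ a)) := by
    have translate (c : ℚ_[p]) : μ.real (Metric.closedBall c ((p : ℝ) ^ a)) =
        μ.real (Metric.closedBall 0 ((p : ℝ) ^ a)) := by
      rw [measureReal_def, measureReal_def, ← Measure.addHaar_closedBall_center]
    rw [Padic.closedBall_zpow_add_one, measureReal_biUnion_finset
      (Padic.pairwiseDisjoint_closedBall_zpow a) (fun _ _ ↦ measurableSet_closedBall)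
      (fun _ _ ↦ measure_closedBall_lt_top.ne)]
    simp [translate]
  induction a using Int.induction_on with
  | zero => simp [measureReal_def, hμ]
  | succ n ih => rw [step, ih, zpow_add_one₀ hp0, mul_comm]
  | pred n ih =>
    have h := step (-n - 1)
    rw [sub_add_cancel, ih] at h
    refine mul_left_cancel₀ hp0 ?_
    rw [← h, ← zpow_one_add₀ hp0, add_sub_cancel]

/-- A function vanishes in integral over an additive subgroup if translation by some element of the
subgroup multiplies it by a constant other than `1`. -/
theorem setIntegral_eq_zero_of_add_right_eq_mul {G : Type*} [AddGroup G] [MeasurableSpace G]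
    [MeasurableAdd G] (μ : Measure G) [μ.IsAddRightInvariant] (H : AddSubgroup G)
    (hH : MeasurableSet (H : Set G)) {f : G → ℂ} {g : G} (hg : g ∈ H) {c : ℂ} (hc : c ≠ 1)
    (hf : ∀ x, f (x + g) = c * f x) : ∫ x in (H : Set G), f x ∂μ = 0 := by
  have h : ∫ x in (H : Set G), f x ∂μ = c * ∫ x in (H : Set G), f x ∂μ := by
    rw [← integral_indicator hH, ← integral_const_mul, ← integral_add_right_eq_self _ g]
    congr 1 with x
    by_cases hx : x ∈ H
    · have hxg : x + g ∈ H := H.add_mem hx hg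
      simp [Set.indicator, hx, hxg, hf]
    · have hxg : x + g ∉ H := fun h ↦ hx ((H.add_mem_cancel_right hg).1 h)
      simp [Set.indicator, hx, hxg]
  have h' : (1 - c) * ∫ x in (H : Set G), f x ∂μ = 0 := by linear_combination h
  exact (mul_eq_zero.1 h').resolve_left (sub_ne_zero.2 hc.symm)

/-- The closed ball of nonnegative radius `r` around `0` in `ℚ_p`, as an additive subgroup. -/
def Padic.closedBallAddSubgroup (p : ℕ) [Fact p.Prime] (r : ℝ) (hr : 0 ≤ r) :
    AddSubgroup ℚ_[p] where
  carrier := {x | ‖x‖ ≤ r}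
  zero_mem' := by simpa using hr
  add_mem' hx hy := (Padic.nonarchimedean _ _).trans (max_le hx hy)
  neg_mem' hx := by simpa using hx

end PadicIntegral

/-- For every integer `a` and every `y ∈ ℚ_p`, the integral of the rank-zero
character `χ(x·y)` over the ball `B_a = {x : |x| ≤ p^a}` equals `p^a` if `|y| ≤ p^{-a}`
and equals `0` if `|y| > p^{-a}`.  Here `μ` is the Haar measure on `ℚ_p` normalized so
that `μ(ℤ_p) = 1`, and `χ(x) = exp(2πi{x})` where `{x}` is the p-adic fractional part of
`x`, i.e. the unique rational `r ∈ [0,1)` with denominator a power of `p` such that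
`|x - r| ≤ 1`. -/
theorem exit_prob_statement_0 (p : ℕ) [Fact p.Prime]
    [MeasurableSpace ℚ_[p]] [BorelSpace ℚ_[p]]
    (μ : Measure ℚ_[p]) [μ.IsAddHaarMeasure]
    (hμ : μ {x : ℚ_[p] | ‖x‖ ≤ 1} = 1)
    (χ : ℚ_[p] → ℂ)
    (hχ : ∀ (x : ℚ_[p]) (r : ℚ), (∃ (m : ℤ) (k : ℕ), r = (m : ℚ) / (p : ℚ) ^ k) →
      0 ≤ r → r < 1 → ‖x - (r : ℚ_[p])‖ ≤ 1 →
      χ x = Complex.exp (2 * Real.pi * Complex.I * (r : ℂ)))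
    (a : ℤ) (y : ℚ_[p]) :
    (‖y‖ ≤ (p : ℝ) ^ (-a) →
      ∫ x in {x : ℚ_[p] | ‖x‖ ≤ (p : ℝ) ^ a}, χ (x * y) ∂μ = (((p : ℝ) ^ a : ℝ) : ℂ)) ∧
    ((p : ℝ) ^ (-a) < ‖y‖ →
      ∫ x in {x : ℚ_[p] | ‖x‖ ≤ (p : ℝ) ^ a}, χ (x * y) ∂μ = 0) := by
  have hp : p.Prime := Fact.out
  have hp0 : (0 : ℝ) < p := mod_cast hp.pos
  have hpQ : (p : ℚ) ≠ 0 := mod_cast hp.ne_zero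
  have hball (r : ℝ) : {x : ℚ_[p] | ‖x‖ ≤ r} = Metric.closedBall 0 r := by
    ext x; simp
  have χ_eq_one (x : ℚ_[p]) (hx : ‖x‖ ≤ 1) : χ x = 1 := by
    simpa using hχ x 0 ⟨0, 0, by simp⟩ le_rfl one_pos (by simpa using hx)
  have χ_add (x x' : ℚ_[p]) : χ (x + x') = χ x' * χ x := by
    obtain ⟨r, ⟨m, k, hr⟩, hr0, hr1, hxr⟩ := Padic.exists_fractionalPart x
    obtain ⟨s, ⟨n, l, hs⟩, hs0, hs1, hxs⟩ := Padic.exists_fractionalPart x'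
    have hnorm : ‖x + x' - ((r + s : ℚ) : ℚ_[p])‖ ≤ 1 := by
      rw [show x + x' - ((r + s : ℚ) : ℚ_[p]) = (x - r) + (x' - s) by push_cast; ring]
      exact (Padic.nonarchimedean _ _).trans (max_le hxr hxs)
    rw [hχ x r ⟨m, k, hr⟩ hr0 hr1 hxr, hχ x' s ⟨n, l, hs⟩ hs0 hs1 hxs, ← Complex.exp_add]
    rcases lt_or_ge (r + s) 1 with h | h
    · rw [hχ (x + x') (r + s) ⟨m * p ^ l + n * p ^ k, k + l, ?_⟩ (by positivity) h hnorm]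
      · congr 1; push_cast; ring
      · rw [hr, hs, pow_add]; push_cast; field_simp
    · rw [hχ (x + x') (r + s - 1) ⟨m * p ^ l + n * p ^ k - p ^ k * p ^ l, k + l, ?_⟩
        (by linarith) (by linarith) ?_]
      · rw [← Complex.exp_periodic]
        congr 1; push_cast; ring
      · rw [hr, hs, pow_add]; push_cast; field_simp
      · rw [show x + x' - ((r + s - 1 : ℚ) : ℚ_[p]) = (x + x' - ((r + s : ℚ) : ℚ_[p])) + 1 by
          push_cast; ring]
        exact (Padic.nonarchimedean _ _).trans (max_le hnorm (by simp))
  have χ_inv_ne : χ (p : ℚ_[p])⁻¹ ≠ 1 := by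
    rw [hχ _ (p : ℚ)⁻¹ ⟨1, 1, by simp⟩ (by positivity)
      (inv_lt_one_of_one_lt₀ (mod_cast hp.one_lt)) (by simp)]
    have h := (Complex.isPrimitiveRoot_exp p hp.ne_zero).ne_one hp.one_lt
    simpa [div_eq_mul_inv] using h
  refine ⟨fun hy ↦ ?_, fun hy ↦ ?_⟩
  · have hone : ∀ x ∈ Metric.closedBall (0 : ℚ_[p]) ((p : ℝ) ^ a), χ (x * y) = 1 := by
      intro x hx
      rw [mem_closedBall_zero_iff] at hx
      refine χ_eq_one _ ?_
      calc ‖x * y‖ ≤ (p : ℝ) ^ a * (p : ℝ) ^ (-a) := by rw [norm_mul]; gcongr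
        _ = 1 := by rw [← zpow_add₀ hp0.ne', add_neg_cancel, zpow_zero]
    rw [hball] at hμ ⊢
    rw [setIntegral_congr_fun measurableSet_closedBall hone, setIntegral_const,
      Padic.measureReal_closedBall_zpow μ hμ]
    simp
  · have hy0 : y ≠ 0 := norm_pos_iff.1 (lt_trans (by positivity) hy)
    have hmem : ‖(p : ℚ_[p])⁻¹ * y⁻¹‖ ≤ (p : ℝ) ^ a := by
      have h : (p : ℝ) ^ (-a + 1) ≤ ‖y‖ := by
        by_contra! h
        rw [← Padic.norm_le_pow_iff_norm_lt_pow_add_one] at h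
        exact h.not_gt hy
      rw [norm_mul, norm_inv, norm_inv, Padic.norm_p, inv_inv, ← div_eq_mul_inv,
        div_le_iff₀ (norm_pos_iff.2 hy0)]
      calc (p : ℝ) = (p : ℝ) ^ a * (p : ℝ) ^ (-a + 1) := by
            rw [← zpow_add₀ hp0.ne', add_neg_cancel_left, zpow_one]
        _ ≤ _ := by gcongr
    refine setIntegral_eq_zero_of_add_right_eq_mul μ
      (Padic.closedBallAddSubgroup p ((p : ℝ) ^ a) (by positivity)) ?_ hmem χ_inv_ne fun x ↦ ?_
    · change MeasurableSet {x : ℚ_[p] | ‖x‖ ≤ (p : ℝ) ^ a}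
      rw [hball]
      exact measurableSet_closedBall
    · rw [add_mul, mul_assoc, inv_mul_cancel₀ hy0, mul_one, χ_add]
end

section
/- For every t > 0 and every x in ℚ_p, the function y ↦ χ(x·y)·exp(−σ·t·|y|^b) is integrable over ℚ_p with respect to μ, and ∫_{ℚ_p} χ(x·y)·exp(−σ·t·|y|^b) dμ(y) = ρ(t,x); in particular this integral is a real number. -/
open MeasureTheory

/-- The fundamental solution `ρ(t,x)` of the p-adic diffusion equation with diffusion
constant `σ` and Vladimirov exponent `b`:
`ρ(t,x) = Σ_{r∈ℤ} (exp(−σ t p^{rb}) − exp(−σ t p^{(r+1)b})) p^r 1_{B_{−r}}(x)`. -/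
noncomputable def rho (p : ℕ) [Fact p.Prime] (σ b : ℝ) (t : ℝ) (x : ℚ_[p]) : ℝ :=
  ∑' r : ℤ,
    (Real.exp (-(σ * t * (p : ℝ) ^ ((r : ℝ) * b))) -
      Real.exp (-(σ * t * (p : ℝ) ^ (((r : ℝ) + 1) * b)))) *
    (p : ℝ) ^ (r : ℤ) *
    Set.indicator {y : ℚ_[p] | ‖y‖ ≤ (p : ℝ) ^ (-r : ℤ)} (fun _ => 1) x

open Filter Topology

namespace PadicCharacter

variable {p : ℕ} [hp : Fact p.Prime]

/-- Every `p`-adic number agrees modulo `ℤ_p` with a rational in `[0, 1)` whose denominator is a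
power of `p`. -/
theorem exists_fract (x : ℚ_[p]) : ∃ r : ℚ, (∃ (m : ℤ) (k : ℕ), r = (m : ℚ) / (p : ℚ) ^ k) ∧
    0 ≤ r ∧ r < 1 ∧ ‖x - (r : ℚ_[p])‖ ≤ 1 := by
  have hp0 : (p : ℚ_[p]) ≠ 0 := mod_cast hp.out.ne_zero
  have hpq : (0 : ℚ) < p := mod_cast hp.out.pos
  have hpr : (1 : ℝ) < p := mod_cast hp.out.one_lt
  obtain ⟨k, hk⟩ := pow_unbounded_of_one_lt ‖x‖ hpr
  have hz : ‖(p : ℚ_[p]) ^ k * x‖ ≤ 1 := by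
    rw [norm_mul, norm_pow, Padic.norm_p, inv_pow, inv_mul_le_iff₀ (by positivity), mul_one]
    exact hk.le
  let z : ℤ_[p] := ⟨_, hz⟩
  have hspec := (PadicInt.norm_le_pow_iff_mem_span_pow (z - (z.appr k : ℤ_[p])) k).2 (z.appr_spec k)
  refine ⟨(z.appr k : ℚ) / (p : ℚ) ^ k, ⟨z.appr k, k, by simp⟩, by positivity, ?_, ?_⟩
  · rw [div_lt_one (by positivity)]
    exact mod_cast z.appr_lt k
  · have h : x - (((z.appr k : ℚ) / (p : ℚ) ^ k : ℚ) : ℚ_[p])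
        = ((p : ℚ_[p]) ^ k)⁻¹ * ((z - z.appr k : ℤ_[p]) : ℚ_[p]) := by
      push_cast
      simp only [z]
      field_simp
    rw [h, norm_mul, norm_inv, norm_pow, Padic.norm_p, inv_pow, inv_inv]
    calc (p : ℝ) ^ k * ‖((z - z.appr k : ℤ_[p]) : ℚ_[p])‖
        ≤ (p : ℝ) ^ k * (p : ℝ) ^ (-k : ℤ) := by gcongr; exact hspec
      _ = 1 := by rw [zpow_neg, zpow_natCast, mul_inv_cancel₀ (by positivity)]

/-- The defining property of the rank-zero additive character `x ↦ exp (2πi{x})`. -/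
def IsRankZero (χ : ℚ_[p] → ℂ) : Prop :=
  ∀ (x : ℚ_[p]) (r : ℚ), (∃ (m : ℤ) (k : ℕ), r = (m : ℚ) / (p : ℚ) ^ k) →
    0 ≤ r → r < 1 → ‖x - (r : ℚ_[p])‖ ≤ 1 →
    χ x = Complex.exp (2 * Real.pi * Complex.I * (r : ℂ))

namespace IsRankZero

variable {χ : ℚ_[p] → ℂ}

theorem map_of_norm_le_one (hχ : IsRankZero χ) {x : ℚ_[p]} (hx : ‖x‖ ≤ 1) : χ x = 1 := by
  simpa using hχ x 0 ⟨0, 0, by simp⟩ le_rfl one_pos (by simpa using hx)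

theorem norm_map (hχ : IsRankZero χ) (x : ℚ_[p]) : ‖χ x‖ = 1 := by
  obtain ⟨r, hr, h0, h1, hx⟩ := exists_fract x
  rw [hχ x r hr h0 h1 hx]
  convert! Complex.norm_exp_ofReal_mul_I (2 * Real.pi * r) using 3
  push_cast
  ring

theorem map_add (hχ : IsRankZero χ) (x y : ℚ_[p]) : χ (x + y) = χ x * χ y := by
  have hpq : (p : ℚ) ≠ 0 := mod_cast hp.out.ne_zero
  obtain ⟨r, ⟨m, k, hr⟩, hr0, hr1, hxr⟩ := exists_fract x
  obtain ⟨s, ⟨n, l, hs⟩, hs0, hs1, hys⟩ := exists_fract y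
  have hrs : r + s = ((m * (p : ℤ) ^ l + n * (p : ℤ) ^ k : ℤ) : ℚ) / (p : ℚ) ^ (k + l) := by
    rw [hr, hs, pow_add]
    push_cast
    field_simp
  have hsub : ‖x + y - ((r + s : ℚ) : ℚ_[p])‖ ≤ 1 := by
    have h : x + y - ((r + s : ℚ) : ℚ_[p]) = (x - r) + (y - s) := by push_cast; ring
    rw [h]
    exact (Padic.nonarchimedean _ _).trans (max_le hxr hys)
  rw [hχ x r ⟨m, k, hr⟩ hr0 hr1 hxr, hχ y s ⟨n, l, hs⟩ hs0 hs1 hys, ← Complex.exp_add]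
  rcases lt_or_ge (r + s) 1 with h | h
  · rw [hχ (x + y) (r + s) ⟨_, _, hrs⟩ (by positivity) h hsub]
    push_cast
    ring_nf
  · have hrs' : r + s - 1 = ((m * (p : ℤ) ^ l + n * (p : ℤ) ^ k - (p : ℤ) ^ (k + l) : ℤ) : ℚ)
        / (p : ℚ) ^ (k + l) := by
      rw [Int.cast_sub, sub_div, ← hrs]
      push_cast
      rw [div_self (by positivity)]
    have hsub' : ‖x + y - ((r + s - 1 : ℚ) : ℚ_[p])‖ ≤ 1 := by
      have h : x + y - ((r + s - 1 : ℚ) : ℚ_[p]) = (x + y - ((r + s : ℚ) : ℚ_[p])) + 1 := by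
        push_cast; ring
      rw [h]
      exact (Padic.nonarchimedean _ _).trans (max_le hsub (by simp))
    rw [hχ (x + y) (r + s - 1) ⟨_, _, hrs'⟩ (by linarith) (by linarith) hsub']
    rw [Complex.exp_eq_exp_iff_exists_int]
    refine ⟨-1, ?_⟩
    push_cast
    ring

theorem map_inv_p_ne_one (hχ : IsRankZero χ) : χ ((p : ℚ_[p])⁻¹) ≠ 1 := by
  have h1 : (1 : ℚ) < p := mod_cast hp.out.one_lt
  rw [hχ _ ((p : ℚ)⁻¹) ⟨1, 1, by simp⟩ (by positivity) (inv_lt_one_of_one_lt₀ h1) (by simp)]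
  have := (Complex.isPrimitiveRoot_exp p hp.out.ne_zero).ne_one hp.out.one_lt
  simpa [div_eq_mul_inv] using this

theorem continuous (hχ : IsRankZero χ) : Continuous χ := by
  rw [continuous_iff_continuousAt]
  intro x
  refine (continuousAt_const (y := χ x)).congr ?_
  filter_upwards [Metric.closedBall_mem_nhds x one_pos] with y hy
  have h := hχ.map_add x (y - x)
  rw [hχ.map_of_norm_le_one (x := y - x) (by simpa [dist_eq_norm] using hy), mul_one,
    add_sub_cancel] at h
  exact h.symm

end IsRankZero

/-- Telescoping decomposition of a radial profile into indicators of balls. -/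
theorem hasSum_indicator_closedBall {E : ℤ → ℝ} (hE : Antitone E) (hlim : Tendsto E atTop (𝓝 0))
    {y : ℚ_[p]} (hy : y ≠ 0) :
    HasSum (fun r : ℤ => (Metric.closedBall (0 : ℚ_[p]) ((p : ℝ) ^ r)).indicator
      (fun _ => E r - E (r + 1)) y) (E (-y.valuation)) := by
  have hpr : (1 : ℝ) < p := mod_cast hp.out.one_lt
  set k := -y.valuation with hk
  have hmem (r : ℤ) : y ∈ Metric.closedBall (0 : ℚ_[p]) ((p : ℝ) ^ r) ↔ k ≤ r := by
    rw [mem_closedBall_zero_iff, Padic.norm_eq_zpow_neg_valuation hy, zpow_le_zpow_iff_right₀ hpr]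
  have hinj : Function.Injective fun n : ℕ => k + n := fun a b h => by simpa using h
  rw [← hinj.hasSum_iff]
  · have h : HasSum (fun n : ℕ => E (k + n) - E (k + n + 1)) (E k) := by
      rw [hasSum_iff_tendsto_nat_of_nonneg fun n => sub_nonneg.2 (hE (by simp))]
      have hsum (n : ℕ) :
          ∑ i ∈ Finset.range n, (E (k + i) - E (k + i + 1)) = E k - E (k + n) := by
        simpa [add_assoc] using Finset.sum_range_sub' (fun i : ℕ => E (k + i)) n
      simp_rw [hsum]
      have ht : Tendsto (fun n : ℕ => k + (n : ℤ)) atTop atTop :=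
        tendsto_atTop_add_const_left _ _ tendsto_natCast_atTop_atTop
      simpa using (hlim.comp ht).const_sub (E k)
    refine h.congr_fun fun n => ?_
    rw [Function.comp_apply, Set.indicator_of_mem ((hmem (k + n)).2 (by simp))]
  · intro r hr
    refine Set.indicator_of_notMem (fun h => hr ?_) _
    exact ⟨(r - k).toNat, by have := (hmem r).1 h; simp; lia⟩

variable [MeasurableSpace ℚ_[p]] [BorelSpace ℚ_[p]] {μ : Measure ℚ_[p]} [μ.IsAddHaarMeasure]

theorem measure_closedBall_succ (r : ℤ) :
    μ (Metric.closedBall 0 ((p : ℝ) ^ (r + 1))) = p * μ (Metric.closedBall 0 ((p : ℝ) ^ r)) := by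
  have hp0 : (p : ℚ_[p]) ≠ 0 := mod_cast hp.out.ne_zero
  have hpr : (1 : ℝ) < p := mod_cast hp.out.one_lt
  set q : ℚ_[p] := (p : ℚ_[p]) ^ (-(r + 1)) with hq
  have hq0 : q ≠ 0 := zpow_ne_zero _ hp0
  have hqn : ‖q‖ = (p : ℝ) ^ (r + 1) := by rw [hq, Padic.norm_p_zpow, neg_neg]
  have hunion : Metric.closedBall (0 : ℚ_[p]) ((p : ℝ) ^ (r + 1))
      = ⋃ m : Fin p, (fun y => -((m : ℕ) * q) + y) ⁻¹' Metric.closedBall 0 ((p : ℝ) ^ r) := by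
    ext y
    simp only [Metric.mem_closedBall, dist_zero_right, Set.mem_iUnion, Set.mem_preimage]
    constructor
    · intro hy
      have hz : ‖q⁻¹ * y‖ ≤ 1 := by
        rw [norm_mul, norm_inv, hqn, inv_mul_le_iff₀ (by positivity), mul_one]
        exact hy
      let z : ℤ_[p] := ⟨_, hz⟩
      refine ⟨⟨z.zmodRepr, z.zmodRepr_lt_p⟩, ?_⟩
      have h : -((z.zmodRepr : ℕ) * q) + y = q * ((z - z.zmodRepr : ℤ_[p]) : ℚ_[p]) := by
        push_cast
        simp only [z]
        field_simp
        ring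
      have hlt : ‖((z - z.zmodRepr : ℤ_[p]) : ℚ_[p])‖ < 1 := z.norm_sub_zmodRepr_lt_one
      rw [Padic.norm_le_pow_iff_norm_lt_pow_add_one, h, norm_mul, hqn]
      exact mul_lt_of_lt_one_right (by positivity) hlt
    · rintro ⟨m, hm⟩
      have h : y = (m : ℕ) * q + (-((m : ℕ) * q) + y) := by ring
      rw [h]
      refine (Padic.nonarchimedean _ _).trans (max_le ?_ ?_)
      · rw [norm_mul, hqn]
        refine mul_le_of_le_one_left (by positivity) ?_
        simpa using Padic.norm_int_le_one (p := p) (m : ℕ)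
      · exact hm.trans (zpow_le_zpow_right₀ hpr.le (by lia))
  have hdisj : Pairwise (Function.onFun Disjoint fun m : Fin p =>
      (fun y => -((m : ℕ) * q) + y) ⁻¹' Metric.closedBall (0 : ℚ_[p]) ((p : ℝ) ^ r)) := by
    intro m n hmn
    rw [Function.onFun, Set.disjoint_left]
    intro y hm hn
    simp only [Metric.mem_closedBall, dist_zero_right, Set.mem_preimage] at hm hn
    apply hmn
    have h : (((m : ℤ) - (n : ℤ) : ℤ) : ℚ_[p]) * q
        = (-((n : ℕ) * q) + y) + -(-((m : ℕ) * q) + y) := by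
      push_cast; ring
    have hle : ‖(((m : ℤ) - (n : ℤ) : ℤ) : ℚ_[p]) * q‖ ≤ (p : ℝ) ^ r := by
      rw [h]
      exact (Padic.nonarchimedean _ _).trans (max_le hn (by rwa [norm_neg]))
    rw [Padic.norm_le_pow_iff_norm_lt_pow_add_one, norm_mul, hqn,
      mul_lt_iff_lt_one_left (by positivity), Padic.norm_intCast_lt_one_iff] at hle
    have := Int.eq_zero_of_abs_lt_dvd hle (by rw [abs_lt]; omega)
    ext
    omega
  rw [hunion, measure_iUnion hdisj fun m =>
    (measurable_const_add _) Metric.isClosed_closedBall.measurableSet]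
  simp only [measure_preimage_add, tsum_fintype, Finset.sum_const, Finset.card_univ,
    Fintype.card_fin, nsmul_eq_mul]

theorem measure_closedBall_zpow (hμ : μ {x : ℚ_[p] | ‖x‖ ≤ 1} = 1) (r : ℤ) :
    μ (Metric.closedBall 0 ((p : ℝ) ^ r)) = ENNReal.ofReal ((p : ℝ) ^ r) := by
  have hp0 : (0 : ℝ) < p := mod_cast hp.out.pos
  have hsucc (r : ℤ) : ENNReal.ofReal ((p : ℝ) ^ (r + 1)) = p * ENNReal.ofReal ((p : ℝ) ^ r) := by
    rw [zpow_add_one₀ hp0.ne', mul_comm, ENNReal.ofReal_mul hp0.le, ENNReal.ofReal_natCast]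
  induction r using Int.induction_on with
  | zero =>
    rw [zpow_zero, ENNReal.ofReal_one, ← hμ]
    congr 1
    ext
    simp
  | succ i ih => rw [measure_closedBall_succ, ih, hsucc]
  | pred i ih =>
    have h := measure_closedBall_succ (μ := μ) (-(i : ℤ) - 1)
    have h' := hsucc (-(i : ℤ) - 1)
    rw [sub_add_cancel] at h h'
    rw [ih, h'] at h
    exact ((ENNReal.mul_right_inj (by simp [hp.out.ne_zero]) (by simp)).1 h).symm

namespace IsRankZero

variable {χ : ℚ_[p] → ℂ}

theorem integrable_indicator_closedBall (hχ : IsRankZero χ) (x : ℚ_[p]) (R : ℝ) :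
    Integrable ((Metric.closedBall 0 R).indicator fun y => χ (x * y)) μ := by
  rw [integrable_indicator_iff Metric.isClosed_closedBall.measurableSet]
  exact (hχ.continuous.comp (continuous_const_mul x)).continuousOn.integrableOn_compact
    (isCompact_closedBall _ _)

theorem integral_indicator_closedBall (hχ : IsRankZero χ)
    (hμ : μ {x : ℚ_[p] | ‖x‖ ≤ 1} = 1) (x : ℚ_[p]) (r : ℤ) :
    ∫ y, (Metric.closedBall 0 ((p : ℝ) ^ r)).indicator (fun y => χ (x * y)) y ∂μ =
      ((p : ℝ) ^ r * Set.indicator {y : ℚ_[p] | ‖y‖ ≤ (p : ℝ) ^ (-r)} (fun _ => 1) x : ℝ) := by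
  have hpr : (1 : ℝ) < p := mod_cast hp.out.one_lt
  by_cases hx : ‖x‖ ≤ (p : ℝ) ^ (-r)
  · have h : (Metric.closedBall 0 ((p : ℝ) ^ r)).indicator (fun y => χ (x * y))
        = (Metric.closedBall 0 ((p : ℝ) ^ r)).indicator fun _ => (1 : ℂ) := by
      refine Set.indicator_congr fun y hy => hχ.map_of_norm_le_one ?_
      rw [mem_closedBall_zero_iff] at hy
      calc ‖x * y‖ = ‖x‖ * ‖y‖ := norm_mul _ _
        _ ≤ (p : ℝ) ^ (-r) * (p : ℝ) ^ r := by gcongr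
        _ = 1 := by rw [zpow_neg, inv_mul_cancel₀ (by positivity)]
    rw [h, integral_indicator Metric.isClosed_closedBall.measurableSet, setIntegral_const,
      Measure.real, measure_closedBall_zpow hμ, ENNReal.toReal_ofReal (by positivity),
      Set.indicator_of_mem (by exact hx)]
    simp
  · rw [Set.indicator_of_notMem (by exact hx), mul_zero, Complex.ofReal_zero]
    have hx0 : x ≠ 0 := by
      rintro rfl
      exact hx (by rw [norm_zero]; positivity)
    have hlt : (p : ℝ) ^ (-r + 1) ≤ ‖x‖ := by
      rw [Padic.norm_le_pow_iff_norm_lt_pow_add_one, not_lt] at hx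
      exact hx
    set y₀ : ℚ_[p] := (p : ℚ_[p])⁻¹ / x with hy₀
    have hxy₀ : x * y₀ = (p : ℚ_[p])⁻¹ := mul_div_cancel₀ _ hx0
    have hy₀n : ‖y₀‖ ≤ (p : ℝ) ^ r := by
      rw [hy₀, norm_div, norm_inv, Padic.norm_p, inv_inv, div_le_iff₀ (norm_pos_iff.2 hx0)]
      calc (p : ℝ) = (p : ℝ) ^ r * (p : ℝ) ^ (-r + 1) := by
            rw [← zpow_add₀ (by positivity)]; simp
        _ ≤ _ := by gcongr
    set F := (Metric.closedBall 0 ((p : ℝ) ^ r)).indicator fun y => χ (x * y) with hF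
    have hshift (y : ℚ_[p]) : F (y + y₀) = χ ((p : ℚ_[p])⁻¹) * F y := by
      have hmem : y + y₀ ∈ Metric.closedBall 0 ((p : ℝ) ^ r) ↔
          y ∈ Metric.closedBall 0 ((p : ℝ) ^ r) := by
        simp only [mem_closedBall_zero_iff]
        constructor <;> intro h
        · rw [← add_neg_cancel_right y y₀]
          exact (Padic.nonarchimedean _ _).trans (max_le h (by rwa [norm_neg]))
        · exact (Padic.nonarchimedean _ _).trans (max_le h hy₀n)
      by_cases hy : y ∈ Metric.closedBall 0 ((p : ℝ) ^ r)
      · rw [hF, Set.indicator_of_mem hy, Set.indicator_of_mem (hmem.2 hy), mul_add, hxy₀,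
          hχ.map_add, mul_comm]
      · rw [hF, Set.indicator_of_notMem hy, Set.indicator_of_notMem (hmem.not.2 hy), mul_zero]
    have h := integral_add_right_eq_self (μ := μ) F y₀
    simp_rw [hshift] at h
    rw [integral_const_mul] at h
    by_contra hne
    exact hχ.map_inv_p_ne_one ((mul_eq_right₀ hne).1 h)

end IsRankZero

/-- The Fourier transform of a radial function with decreasing profile `E`. -/
theorem IsRankZero.integrable_and_integral_radial {χ : ℚ_[p] → ℂ} (hχ : IsRankZero χ)
    (hμ : μ {x : ℚ_[p] | ‖x‖ ≤ 1} = 1) {E : ℤ → ℝ} (hE : Antitone E)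
    (hlim : Tendsto E atTop (𝓝 0))
    (hsum : Summable fun r : ℤ => (E r - E (r + 1)) * (p : ℝ) ^ r)
    {f : ℚ_[p] → ℝ} (hfm : Measurable f) (hf : ∀ y ≠ 0, f y = E (-y.valuation)) (x : ℚ_[p]) :
    Integrable (fun y => χ (x * y) * (f y : ℂ)) μ ∧
    ∫ y, χ (x * y) * (f y : ℂ) ∂μ =
      ((∑' r : ℤ, (E r - E (r + 1)) * (p : ℝ) ^ r *
        Set.indicator {y : ℚ_[p] | ‖y‖ ≤ (p : ℝ) ^ (-r)} (fun _ => 1) x : ℝ) : ℂ) := by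
  have hp0 : (0 : ℝ) < p := mod_cast hp.out.pos
  have hc (r : ℤ) : 0 ≤ E r - E (r + 1) := sub_nonneg.2 (hE (by simp))
  have hne : ∀ᵐ y ∂μ, y ≠ 0 := by simp [ae_iff]
  have hms (r : ℤ) : MeasurableSet (Metric.closedBall (0 : ℚ_[p]) ((p : ℝ) ^ r)) :=
    Metric.isClosed_closedBall.measurableSet
  have hdecomp {y : ℚ_[p]} (hy : y ≠ 0) :
      HasSum (fun r : ℤ => (Metric.closedBall (0 : ℚ_[p]) ((p : ℝ) ^ r)).indicator
        (fun _ => E r - E (r + 1)) y) (f y) := by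
    rw [hf y hy]
    exact hasSum_indicator_closedBall hE hlim hy
  set F : ℤ → ℚ_[p] → ℂ := fun r y =>
    ((E r - E (r + 1) : ℝ) : ℂ) *
      (Metric.closedBall 0 ((p : ℝ) ^ r)).indicator (fun y => χ (x * y)) y with hF
  have hFs {y : ℚ_[p]} (hy : y ≠ 0) : HasSum (F · y) (χ (x * y) * (f y : ℂ)) := by
    refine ((Complex.hasSum_ofReal.2 (hdecomp hy)).mul_left (χ (x * y))).congr_fun fun r => ?_
    simp only [hF, Set.indicator]
    split_ifs
    · exact mul_comm _ _
    · simp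
  constructor
  · refine ⟨?_, ?_⟩
    · exact ((hχ.continuous.comp (continuous_const_mul x)).measurable.mul
        (Complex.measurable_ofReal.comp hfm)).aestronglyMeasurable
    · have h : ∫⁻ y, ‖χ (x * y) * (f y : ℂ)‖ₑ ∂μ =
          ∑' r : ℤ, ENNReal.ofReal ((E r - E (r + 1)) * (p : ℝ) ^ r) := by
        calc ∫⁻ y, ‖χ (x * y) * (f y : ℂ)‖ₑ ∂μ
            = ∫⁻ y, ∑' r : ℤ, (Metric.closedBall (0 : ℚ_[p]) ((p : ℝ) ^ r)).indicator
                (fun _ => ENNReal.ofReal (E r - E (r + 1))) y ∂μ := by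
              refine lintegral_congr_ae (hne.mono fun y hy => ?_)
              have hs := hdecomp hy
              have hnn (r : ℤ) : 0 ≤ (Metric.closedBall (0 : ℚ_[p]) ((p : ℝ) ^ r)).indicator
                  (fun _ => E r - E (r + 1)) y := Set.indicator_nonneg (fun _ _ => hc r) _
              have hfy : 0 ≤ f y := hs.nonneg hnn
              simp only
              rw [← ofReal_norm, norm_mul, hχ.norm_map, one_mul, Complex.norm_real,
                Real.norm_of_nonneg hfy, ← hs.tsum_eq,
                ENNReal.ofReal_tsum_of_nonneg hnn hs.summable]
              refine tsum_congr fun r => ?_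
              simp only [Set.indicator]
              split_ifs <;> simp
          _ = _ := by
              rw [lintegral_tsum fun r => (measurable_const.indicator (hms r)).aemeasurable]
              refine tsum_congr fun r => ?_
              rw [lintegral_indicator_const (hms r), measure_closedBall_zpow hμ,
                ENNReal.ofReal_mul (hc r)]
      rw [HasFiniteIntegral, h]
      exact hsum.tsum_ofReal_lt_top
  · have hFi (r : ℤ) : Integrable (F r) μ :=
      (hχ.integrable_indicator_closedBall x _).const_mul _
    have hFn (r : ℤ) : ∫ y, ‖F r y‖ ∂μ = (E r - E (r + 1)) * (p : ℝ) ^ r := by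
      have h (y : ℚ_[p]) : ‖F r y‖ = (Metric.closedBall (0 : ℚ_[p]) ((p : ℝ) ^ r)).indicator
          (fun _ => E r - E (r + 1)) y := by
        rw [hF, norm_mul, Complex.norm_real, Real.norm_of_nonneg (hc r)]
        simp only [Set.indicator]
        split_ifs <;> simp [hχ.norm_map]
      simp_rw [h]
      rw [integral_indicator_const _ (hms r), Measure.real, measure_closedBall_zpow hμ,
        ENNReal.toReal_ofReal (by positivity), smul_eq_mul, mul_comm]
    have h := integral_tsum_of_summable_integral_norm hFi (by simpa only [hFn] using hsum)
    rw [integral_congr_ae (hne.mono fun y hy => (hFs hy).tsum_eq)] at h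
    rw [← h, Complex.ofReal_tsum]
    refine tsum_congr fun r => ?_
    rw [hF, integral_const_mul, hχ.integral_indicator_closedBall hμ, mul_assoc]
    push_cast
    rfl

theorem summable_exp_sub_exp_mul_zpow {p : ℕ} (hp : 1 < p) {a b : ℝ} (ha : 0 < a) (hb : 0 < b) :
    Summable fun r : ℤ => (Real.exp (-(a * (p : ℝ) ^ ((r : ℝ) * b))) -
      Real.exp (-(a * (p : ℝ) ^ (((r : ℝ) + 1) * b)))) * (p : ℝ) ^ r := by
  have hpr : (1 : ℝ) < p := mod_cast hp
  have hp0 : (0 : ℝ) < p := by positivity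
  have hgeom : Summable fun n : ℕ => ((p : ℝ)⁻¹) ^ n :=
    summable_geometric_of_lt_one (by positivity) (inv_lt_one_of_one_lt₀ hpr)
  have hle (r : ℤ) : ‖(Real.exp (-(a * (p : ℝ) ^ ((r : ℝ) * b))) -
      Real.exp (-(a * (p : ℝ) ^ (((r : ℝ) + 1) * b)))) * (p : ℝ) ^ r‖ ≤
      Real.exp (-(a * (p : ℝ) ^ ((r : ℝ) * b))) * (p : ℝ) ^ r := by
    have hmono : (p : ℝ) ^ ((r : ℝ) * b) ≤ (p : ℝ) ^ (((r : ℝ) + 1) * b) :=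
      Real.rpow_le_rpow_of_exponent_le hpr.le (by nlinarith)
    rw [norm_mul, Real.norm_of_nonneg (by positivity : (0 : ℝ) ≤ (p : ℝ) ^ r), Real.norm_of_nonneg]
    · gcongr
      exact sub_le_self _ (Real.exp_pos _).le
    · rw [sub_nonneg]
      gcongr
  apply Summable.of_nat_of_neg
  · obtain ⟨N, hN⟩ := exists_nat_ge (2 / b)
    rw [div_le_iff₀ hb] at hN
    refine (hgeom.mul_left (N.factorial / a ^ N)).of_norm_bounded fun n => (hle n).trans ?_
    set z := a * (p : ℝ) ^ (((n : ℤ) : ℝ) * b) with hz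
    have hz0 : 0 < z := by positivity
    have hzN : a ^ N * (p : ℝ) ^ (2 * n) ≤ z ^ N := by
      rw [hz, mul_pow, ← Real.rpow_natCast (p ^ _) N, ← Real.rpow_mul hp0.le,
        ← Real.rpow_natCast (p : ℝ) (2 * n)]
      gcongr
      · exact hpr.le
      · push_cast
        nlinarith [(Nat.cast_nonneg n : (0 : ℝ) ≤ n)]
    have hexp := Real.pow_div_factorial_le_exp z hz0.le N
    have hfac : (0 : ℝ) < N.factorial := mod_cast N.factorial_pos
    rw [Real.exp_neg, zpow_natCast]
    calc (Real.exp z)⁻¹ * (p : ℝ) ^ n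
        ≤ (a ^ N * (p : ℝ) ^ (2 * n) / N.factorial)⁻¹ * (p : ℝ) ^ n := by
          gcongr
          exact (div_le_div_of_nonneg_right hzN hfac.le).trans hexp
      _ = N.factorial / a ^ N * (p : ℝ)⁻¹ ^ n := by
          rw [two_mul, pow_add, inv_pow]
          field_simp
  · refine hgeom.of_norm_bounded fun n => (hle _).trans ?_
    rw [zpow_neg, zpow_natCast, inv_pow]
    refine mul_le_of_le_one_left (by positivity) ?_
    rw [Real.exp_le_one_iff, neg_nonpos]
    positivity

end PadicCharacter

/-- For every `t > 0` and `x ∈ ℚ_p`, the function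
`y ↦ χ(x·y)·exp(−σ·t·|y|^b)` is integrable over `ℚ_p` with respect to the normalized
Haar measure `μ`, and its integral equals `ρ(t,x)`; in particular the integral is a
real number. -/
theorem exit_prob_statement_1 (p : ℕ) [Fact p.Prime]
    [MeasurableSpace ℚ_[p]] [BorelSpace ℚ_[p]]
    (μ : Measure ℚ_[p]) [μ.IsAddHaarMeasure]
    (hμ : μ {x : ℚ_[p] | ‖x‖ ≤ 1} = 1)
    (σ b : ℝ) (hσ : 0 < σ) (hb : 0 < b)
    (χ : ℚ_[p] → ℂ)
    (hχ : ∀ (x : ℚ_[p]) (r : ℚ), (∃ (m : ℤ) (k : ℕ), r = (m : ℚ) / (p : ℚ) ^ k) →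
      0 ≤ r → r < 1 → ‖x - (r : ℚ_[p])‖ ≤ 1 →
      χ x = Complex.exp (2 * Real.pi * Complex.I * (r : ℂ)))
    (t : ℝ) (ht : 0 < t) (x : ℚ_[p]) :
    Integrable (fun y : ℚ_[p] => χ (x * y) * (Real.exp (-(σ * t * ‖y‖ ^ b)) : ℂ)) μ ∧
    ∫ y, χ (x * y) * (Real.exp (-(σ * t * ‖y‖ ^ b)) : ℂ) ∂μ = ((rho p σ b t x : ℝ) : ℂ) := by
  have hp0 : (0 : ℝ) < p := mod_cast (Fact.out : p.Prime).pos
  have hpr : (1 : ℝ) < p := mod_cast (Fact.out : p.Prime).one_lt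
  have hst : 0 < σ * t := mul_pos hσ ht
  set E : ℤ → ℝ := fun r => Real.exp (-(σ * t * (p : ℝ) ^ ((r : ℝ) * b))) with hE
  have hanti : Antitone E := fun r s hrs => by
    have hrs' : (r : ℝ) ≤ s := mod_cast hrs
    simp only [hE]
    gcongr
    exact hpr.le
  have hlim : Tendsto E atTop (𝓝 0) := by
    refine Real.tendsto_exp_neg_atTop_nhds_zero.comp (Tendsto.const_mul_atTop hst ?_)
    exact (tendsto_rpow_atTop_of_base_gt_one _ hpr).comp
      (tendsto_intCast_atTop_atTop.atTop_mul_const hb)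
  have hsum : Summable fun r : ℤ => (E r - E (r + 1)) * (p : ℝ) ^ r := by
    simpa [hE] using PadicCharacter.summable_exp_sub_exp_mul_zpow (Fact.out : p.Prime).one_lt hst hb
  have hχ' : PadicCharacter.IsRankZero χ := hχ
  have hfm : Measurable fun y : ℚ_[p] => Real.exp (-(σ * t * ‖y‖ ^ b)) := by fun_prop
  have h := hχ'.integrable_and_integral_radial hμ hanti hlim hsum hfm (fun y hy => by
    simp only [hE]
    rw [Padic.norm_eq_zpow_neg_valuation hy, ← Real.rpow_intCast, ← Real.rpow_mul hp0.le]) x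
  simpa [rho, hE] using h
end

section
/- For every t > 0 and every x in ℚ_p, ρ(t,x) > 0. -/
open MeasureTheory

/-- The coefficient of `1_{B_{-r}}` in `rho`. -/
noncomputable def rhoCoeff (p : ℕ) (σ b t : ℝ) (r : ℤ) : ℝ :=
  (Real.exp (-(σ * t * (p : ℝ) ^ ((r : ℝ) * b))) -
    Real.exp (-(σ * t * (p : ℝ) ^ (((r : ℝ) + 1) * b)))) * (p : ℝ) ^ (r : ℤ)

theorem rhoCoeff_pos {p : ℕ} (hp : 1 < p) {σ b t : ℝ} (hσ : 0 < σ) (hb : 0 < b) (ht : 0 < t)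
    (r : ℤ) : 0 < rhoCoeff p σ b t r := by
  have hp' : (1 : ℝ) < p := by exact_mod_cast hp
  refine mul_pos (sub_pos.2 (Real.exp_lt_exp.2 (neg_lt_neg ?_))) (zpow_pos (by linarith) r)
  exact mul_lt_mul_of_pos_left (Real.rpow_lt_rpow_of_exponent_lt hp' (by linarith))
    (mul_pos hσ ht)

theorem rhoCoeff_le (p : ℕ) (σ b t : ℝ) (r : ℤ) :
    rhoCoeff p σ b t r ≤ Real.exp (-(σ * t * (p : ℝ) ^ ((r : ℝ) * b))) * (p : ℝ) ^ (r : ℤ) :=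
  mul_le_mul_of_nonneg_right (sub_le_self _ (Real.exp_pos _).le) (by positivity)

theorem exp_neg_le_factorial_div_pow {x : ℝ} (hx : 0 < x) (k : ℕ) :
    Real.exp (-x) ≤ k.factorial / x ^ k := by
  rw [Real.exp_neg, ← inv_div]
  exact inv_anti₀ (by positivity) (Real.pow_div_factorial_le_exp x hx.le k)

theorem summable_rhoCoeff {p : ℕ} (hp : 1 < p) {σ b t : ℝ} (hσ : 0 < σ) (hb : 0 < b)
    (ht : 0 < t) : Summable (rhoCoeff p σ b t) := by
  have hp' : (1 : ℝ) < p := by exact_mod_cast hp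
  have hp0 : (0 : ℝ) < p := by linarith
  have hgeom : Summable fun n : ℕ => ((p : ℝ)⁻¹) ^ n :=
    summable_geometric_of_lt_one (by positivity) (inv_lt_one_of_one_lt₀ hp')
  refine Summable.of_nat_of_neg ?_ ?_
  · obtain ⟨k, hk⟩ := exists_nat_ge (2 / b)
    rw [div_le_iff₀ hb] at hk
    refine (hgeom.mul_left (k.factorial / (σ * t) ^ k)).of_nonneg_of_le
      (fun n => (rhoCoeff_pos hp hσ hb ht _).le) fun n => (rhoCoeff_le p σ b t n).trans ?_
    have hpow : ((p : ℝ) ^ n) ^ 2 ≤ ((p : ℝ) ^ ((n : ℝ) * b)) ^ k := by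
      rw [← pow_mul, ← Real.rpow_natCast, ← Real.rpow_natCast, ← Real.rpow_mul hp0.le]
      refine Real.rpow_le_rpow_of_exponent_le hp'.le ?_
      push_cast
      nlinarith [mul_le_mul_of_nonneg_left hk (Nat.cast_nonneg (α := ℝ) n)]
    have hexp := exp_neg_le_factorial_div_pow
      (x := σ * t * (p : ℝ) ^ ((n : ℝ) * b)) (by positivity) k
    simp only [Int.cast_natCast, zpow_natCast]
    calc Real.exp (-(σ * t * (p : ℝ) ^ ((n : ℝ) * b))) * (p : ℝ) ^ n
        ≤ k.factorial / (σ * t * (p : ℝ) ^ ((n : ℝ) * b)) ^ k * (p : ℝ) ^ n := by gcongr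
      _ = k.factorial / ((σ * t) ^ k * ((p : ℝ) ^ ((n : ℝ) * b)) ^ k) * (p : ℝ) ^ n := by
        rw [mul_pow (σ * t)]
      _ ≤ k.factorial / ((σ * t) ^ k * ((p : ℝ) ^ n) ^ 2) * (p : ℝ) ^ n := by gcongr
      _ = k.factorial / (σ * t) ^ k * ((p : ℝ)⁻¹) ^ n := by
        rw [inv_pow]
        field_simp
  · refine hgeom.of_nonneg_of_le (fun n => (rhoCoeff_pos hp hσ hb ht _).le) fun n =>
      (rhoCoeff_le p σ b t _).trans ?_
    rw [zpow_neg, zpow_natCast, inv_pow]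
    refine mul_le_of_le_one_left (by positivity) (Real.exp_le_one_iff.2 ?_)
    exact neg_nonpos.2 (by positivity)

theorem exists_padic_norm_le_zpow_neg {p : ℕ} [Fact p.Prime] (x : ℚ_[p]) :
    ∃ r : ℤ, ‖x‖ ≤ (p : ℝ) ^ (-r : ℤ) := by
  rcases eq_or_ne x 0 with rfl | hx
  · exact ⟨0, by simp⟩
  · exact ⟨x.valuation, (Padic.norm_eq_zpow_neg_valuation hx).le⟩

/-- For every `t > 0` and every `x ∈ ℚ_p`, `ρ(t,x) > 0`, where `ρ` is the
fundamental solution of the p-adic diffusion equation with diffusion constant `σ > 0`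
and Vladimirov exponent `b > 0`. -/
theorem exit_prob_statement_2 (p : ℕ) [Fact p.Prime]
    (σ b : ℝ) (hσ : 0 < σ) (hb : 0 < b)
    (t : ℝ) (ht : 0 < t) (x : ℚ_[p]) :
    0 < rho p σ b t x := by
  have hp : 1 < p := (Fact.out : p.Prime).one_lt
  have hpos := rhoCoeff_pos hp hσ hb ht
  have hnonneg (r : ℤ) : 0 ≤ rhoCoeff p σ b t r *
      Set.indicator {y : ℚ_[p] | ‖y‖ ≤ (p : ℝ) ^ (-r : ℤ)} (fun _ => 1) x :=
    mul_nonneg (hpos r).le (Set.indicator_nonneg (fun _ _ => zero_le_one) x)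
  obtain ⟨r, hr⟩ := exists_padic_norm_le_zpow_neg x
  refine ((summable_rhoCoeff hp hσ hb ht).of_nonneg_of_le hnonneg fun s => ?_).tsum_pos
    hnonneg r ?_
  · exact mul_le_of_le_one_right (hpos s).le
      (Set.indicator_le_self' (fun _ _ => zero_le_one) x)
  · rw [Set.indicator_of_mem (by exact hr), mul_one]
    exact hpos r
end

section
/- For every t > 0, ρ(t,·) is a probability density: the function x ↦ ρ(t,x) is integrable over ℚ_p with respect to μ and ∫_{ℚ_p} ρ(t,x) dμ(x) = 1. -/
open MeasureTheory

open Filter Topology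

section PadicBalls

variable {p : ℕ} [Fact p.Prime]

theorem Padic.norm_p_zpow_mul_le_one_iff (n : ℤ) (x : ℚ_[p]) :
    ‖(p : ℚ_[p]) ^ n * x‖ ≤ 1 ↔ ‖x‖ ≤ (p : ℝ) ^ n := by
  have hp : (0 : ℝ) < (p : ℝ) ^ n := zpow_pos (mod_cast (Fact.out : p.Prime).pos) n
  rw [norm_mul, Padic.norm_p_zpow, zpow_neg, inv_mul_le_iff₀ hp, mul_one]

theorem Padic.norm_p_zpow_mul_lt_one_iff (n : ℤ) (x : ℚ_[p]) :
    ‖(p : ℚ_[p]) ^ (n + 1) * x‖ < 1 ↔ ‖x‖ ≤ (p : ℝ) ^ n := by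
  have hp : (0 : ℝ) < (p : ℝ) ^ (n + 1) := zpow_pos (mod_cast (Fact.out : p.Prime).pos) _
  rw [norm_mul, Padic.norm_p_zpow, zpow_neg, inv_mul_lt_iff₀ hp, mul_one,
    Padic.norm_le_pow_iff_norm_lt_pow_add_one]

theorem PadicInt.norm_coe_sub_natCast_lt_one_iff (y : ℤ_[p]) {i : ℕ} (hi : i < p) :
    ‖(y : ℚ_[p]) - i‖ < 1 ↔ i = y.zmodRepr := by
  rw [← PadicInt.coe_natCast, ← PadicInt.coe_sub, ← PadicInt.norm_def]
  constructor
  · intro h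
    refine (y.zmodRepr_unique i hi ?_).symm
    rwa [IsLocalRing.mem_maximalIdeal, PadicInt.mem_nonunits]
  · rintro rfl
    exact y.norm_sub_zmodRepr_lt_one

variable (p) in
theorem Padic.ball_succ_eq_biUnion (n : ℤ) :
    {x : ℚ_[p] | ‖x‖ ≤ (p : ℝ) ^ (n + 1)} = ⋃ i ∈ Finset.range p,
      {x : ℚ_[p] | ‖(p : ℚ_[p]) ^ (n + 1) * x - (i : ℕ)‖ < 1} := by
  ext x
  simp only [Set.mem_ofPred_eq, Set.mem_iUnion, Finset.mem_range, exists_prop]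
  rw [← Padic.norm_p_zpow_mul_le_one_iff]
  constructor
  · intro h
    let y : ℤ_[p] := ⟨_, h⟩
    exact ⟨_, y.zmodRepr_lt_p, (y.norm_coe_sub_natCast_lt_one_iff y.zmodRepr_lt_p).2 rfl⟩
  · rintro ⟨i, -, h⟩
    have hi : ‖(i : ℚ_[p])‖ ≤ 1 := mod_cast Padic.norm_int_le_one (p := p) (i : ℤ)
    calc _ = ‖((p : ℚ_[p]) ^ (n + 1) * x - i) + i‖ := by rw [sub_add_cancel]
      _ ≤ _ := Padic.nonarchimedean _ _
      _ ≤ 1 := max_le h.le hi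

variable [MeasurableSpace ℚ_[p]] [BorelSpace ℚ_[p]]

theorem Padic.measurableSet_ball (r : ℝ) : MeasurableSet {x : ℚ_[p] | ‖x‖ ≤ r} :=
  measurableSet_le measurable_norm measurable_const

theorem Padic.measure_ball_succ (μ : Measure ℚ_[p]) [μ.IsAddHaarMeasure] (n : ℤ) :
    μ {x : ℚ_[p] | ‖x‖ ≤ (p : ℝ) ^ (n + 1)} = p * μ {x : ℚ_[p] | ‖x‖ ≤ (p : ℝ) ^ n} := by
  have hp : (p : ℚ_[p]) ≠ 0 := mod_cast (Fact.out : p.Prime).ne_zero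
  have translate (i : ℕ) : {x : ℚ_[p] | ‖(p : ℚ_[p]) ^ (n + 1) * x - i‖ < 1} =
      (fun x => x + -(((p : ℚ_[p]) ^ (n + 1))⁻¹ * i)) ⁻¹' {x | ‖x‖ ≤ (p : ℝ) ^ n} := by
    ext x
    simp only [Set.mem_ofPred_eq, Set.mem_preimage]
    rw [← Padic.norm_p_zpow_mul_lt_one_iff, ← sub_eq_add_neg, mul_sub,
      mul_inv_cancel_left₀ (zpow_ne_zero _ hp)]
  rw [Padic.ball_succ_eq_biUnion, measure_biUnion_finset]
  · simp only [translate, measure_preimage_add_right]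
    simp
  · intro i hi j hj hij
    refine Set.disjoint_left.2 fun x hxi hxj => hij ?_
    simp only [Finset.coe_range, Set.mem_Iio] at hi hj
    have hx : ‖(p : ℚ_[p]) ^ (n + 1) * x‖ ≤ 1 := by
      rw [Padic.norm_p_zpow_mul_le_one_iff]
      have : x ∈ {x : ℚ_[p] | ‖x‖ ≤ (p : ℝ) ^ (n + 1)} := by
        rw [Padic.ball_succ_eq_biUnion]
        exact Set.mem_biUnion (Finset.mem_coe.2 (Finset.mem_range.2 hi)) hxi
      exact this
    let y : ℤ_[p] := ⟨_, hx⟩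
    exact ((y.norm_coe_sub_natCast_lt_one_iff hi).1 hxi).trans
      ((y.norm_coe_sub_natCast_lt_one_iff hj).1 hxj).symm
  · intro i _
    rw [translate]
    exact measurable_add_const _ (Padic.measurableSet_ball _)

theorem Padic.measureReal_ball (μ : Measure ℚ_[p]) [μ.IsAddHaarMeasure]
    (hμ : μ {x : ℚ_[p] | ‖x‖ ≤ 1} = 1) (n : ℤ) :
    μ.real {x : ℚ_[p] | ‖x‖ ≤ (p : ℝ) ^ n} = (p : ℝ) ^ n := by
  have hp : (p : ℝ) ≠ 0 := mod_cast (Fact.out : p.Prime).ne_zero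
  have succ (n : ℤ) : μ.real {x : ℚ_[p] | ‖x‖ ≤ (p : ℝ) ^ (n + 1)} =
      p * μ.real {x : ℚ_[p] | ‖x‖ ≤ (p : ℝ) ^ n} := by
    simp [measureReal_def, Padic.measure_ball_succ]
  induction n with
  | zero => simp [measureReal_def, hμ]
  | succ n ih => rw [succ, ih, zpow_add_one₀ hp, mul_comm]
  | pred n ih =>
    have h := succ (-(n : ℤ) - 1)
    rw [sub_add_cancel, ih] at h
    refine mul_left_cancel₀ hp (h.symm.trans ?_)
    rw [mul_comm, ← zpow_add_one₀ hp, sub_add_cancel]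

theorem Padic.integrable_indicator_ball (μ : Measure ℚ_[p]) [μ.IsAddHaarMeasure] (r : ℝ) :
    Integrable ({x : ℚ_[p] | ‖x‖ ≤ r}.indicator fun _ => (1 : ℝ)) μ := by
  refine (integrable_indicator_iff (Padic.measurableSet_ball r)).2 (integrableOn_const ?_)
  have h : {x : ℚ_[p] | ‖x‖ ≤ r} = Metric.closedBall 0 r := by ext; simp
  rw [h]
  exact (isCompact_closedBall 0 r).measure_ne_top

end PadicBalls

theorem Antitone.hasSum_int_sub_succ {f : ℤ → ℝ} (hf : Antitone f) {a b : ℝ}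
    (ha : Tendsto f atBot (𝓝 a)) (hb : Tendsto f atTop (𝓝 b)) :
    HasSum (fun n => f n - f (n + 1)) (a - b) := by
  have nonneg (n : ℤ) : 0 ≤ f n - f (n + 1) := sub_nonneg.2 (hf (by lia))
  have hpos : HasSum (fun n : ℕ => f n - f (n + 1)) (f 0 - b) := by
    rw [hasSum_iff_tendsto_nat_of_nonneg fun n => nonneg n]
    have h (N : ℕ) : ∑ n ∈ Finset.range N, (f n - f (n + 1)) = f 0 - f N := by
      simpa using Finset.sum_range_sub' (fun n : ℕ => f n) N
    simp only [h]
    exact tendsto_const_nhds.sub (hb.comp tendsto_natCast_atTop_atTop)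
  have hneg : HasSum (fun n : ℕ => f (-(n + 1 : ℤ)) - f (-(n + 1 : ℤ) + 1)) (a - f 0) := by
    rw [hasSum_iff_tendsto_nat_of_nonneg fun n => nonneg _]
    have h (N : ℕ) : ∑ n ∈ Finset.range N, (f (-(n + 1 : ℤ)) - f (-(n + 1 : ℤ) + 1)) =
        f (-N) - f 0 := by
      simpa using Finset.sum_range_sub (fun n : ℕ => f (-n)) N
    simp only [h]
    exact (ha.comp (tendsto_neg_atTop_atBot.comp tendsto_natCast_atTop_atTop)).sub
      tendsto_const_nhds
  have h := HasSum.of_nat_of_neg_add_one (f := fun n : ℤ => f n - f (n + 1)) hpos hneg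
  rwa [sub_add_sub_cancel'] at h

section Decay

variable {c q b : ℝ}

theorem antitone_exp_neg_mul_rpow (hc : 0 < c) (hq : 1 < q) (hb : 0 < b) :
    Antitone fun r : ℤ => Real.exp (-(c * q ^ ((r : ℝ) * b))) := by
  intro r s hrs
  have : (r : ℝ) ≤ s := mod_cast hrs
  dsimp only
  gcongr
  exact hq.le

theorem tendsto_exp_neg_mul_rpow_atTop (hc : 0 < c) (hq : 1 < q) (hb : 0 < b) :
    Tendsto (fun r : ℤ => Real.exp (-(c * q ^ ((r : ℝ) * b)))) atTop (𝓝 0) := by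
  refine Real.tendsto_exp_neg_atTop_nhds_zero.comp (Tendsto.const_mul_atTop hc ?_)
  exact (tendsto_rpow_atTop_of_base_gt_one q hq).comp
    (tendsto_intCast_atTop_atTop.atTop_mul_const hb)

theorem tendsto_exp_neg_mul_rpow_atBot (c : ℝ) (hq : 1 < q) (hb : 0 < b) :
    Tendsto (fun r : ℤ => Real.exp (-(c * q ^ ((r : ℝ) * b)))) atBot (𝓝 1) := by
  have h : Tendsto (fun r : ℤ => q ^ ((r : ℝ) * b)) atBot (𝓝 0) :=
    (tendsto_rpow_atBot_of_base_gt_one q hq).comp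
      ((tendsto_intCast_atBot_iff.2 tendsto_id).atBot_mul_const hb)
  simpa [Function.comp_def] using (Real.continuous_exp.tendsto _).comp (h.const_mul c).neg

end Decay

/-- For every `t > 0`, `ρ(t,·)` is a probability density with respect to
the Haar measure `μ` on `ℚ_p` normalized so that `μ(ℤ_p) = 1`: it is integrable and
`∫_{ℚ_p} ρ(t,x) dμ(x) = 1`. -/
theorem exit_prob_statement_3 (p : ℕ) [Fact p.Prime]
    [MeasurableSpace ℚ_[p]] [BorelSpace ℚ_[p]]
    (μ : Measure ℚ_[p]) [μ.IsAddHaarMeasure]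
    (hμ : μ {x : ℚ_[p] | ‖x‖ ≤ 1} = 1)
    (σ b : ℝ) (hσ : 0 < σ) (hb : 0 < b)
    (t : ℝ) (ht : 0 < t) :
    Integrable (fun x : ℚ_[p] => rho p σ b t x) μ ∧
    ∫ x, rho p σ b t x ∂μ = 1 := by
  have hp : 1 < (p : ℝ) := mod_cast (Fact.out : p.Prime).one_lt
  have hc : 0 < σ * t := mul_pos hσ ht
  set f : ℤ → ℝ := fun r => Real.exp (-(σ * t * (p : ℝ) ^ ((r : ℝ) * b))) with hf
  set F : ℤ → ℚ_[p] → ℝ := fun r x => (f r - f (r + 1)) * (p : ℝ) ^ (r : ℤ) *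
    Set.indicator {y : ℚ_[p] | ‖y‖ ≤ (p : ℝ) ^ (-r : ℤ)} (fun _ => 1) x with hF
  have anti : Antitone f := antitone_exp_neg_mul_rpow hc hp hb
  have rho_eq : (fun x => rho p σ b t x) = fun x => ∑' r, F r x := by
    funext x
    simp only [rho, hF, hf, Int.cast_add, Int.cast_one]
  have hsum : HasSum (fun r => f r - f (r + 1)) 1 := by
    simpa using anti.hasSum_int_sub_succ (tendsto_exp_neg_mul_rpow_atBot (σ * t) hp hb)
      (tendsto_exp_neg_mul_rpow_atTop hc hp hb)
  have F_integrable (r : ℤ) : Integrable (F r) μ :=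
    (Padic.integrable_indicator_ball μ _).const_mul _
  have F_integral (r : ℤ) : ∫ x, F r x ∂μ = f r - f (r + 1) := by
    rw [hF, integral_const_mul, integral_indicator_const _ (Padic.measurableSet_ball _),
      Padic.measureReal_ball μ hμ, smul_eq_mul, mul_one, mul_assoc,
      ← zpow_add₀ (by positivity), add_neg_cancel, zpow_zero, mul_one]
  have F_nonneg (r : ℤ) (x : ℚ_[p]) : 0 ≤ F r x :=
    mul_nonneg (mul_nonneg (sub_nonneg.2 (anti (by lia))) (by positivity))
      (Set.indicator_nonneg (fun _ _ => zero_le_one) x)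
  have norm_summable : Summable fun r => ∫ x, ‖F r x‖ ∂μ := by
    simpa only [Real.norm_of_nonneg (F_nonneg _ _), F_integral] using hsum.summable
  have integral_eq : ∫ x, rho p σ b t x ∂μ = 1 := by
    have h := hasSum_integral_of_summable_integral_norm F_integrable norm_summable
    simp only [F_integral] at h
    rw [rho_eq]
    exact h.unique hsum
  exact ⟨Integrable.of_integral_ne_zero (by simp [integral_eq]), integral_eq⟩
end

section
/- (Chapman–Kolmogorov identity for the p-adic heat kernel) For all t > 0, t' > 0 and every z in ℚ_p, ∫_{ℚ_p} ρ(t,x)·ρ(t', z−x) dμ(x) = ρ(t+t', z). -/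
open MeasureTheory

open Metric Filter Topology ENNReal Set

section Balls

variable {p : ℕ} [Fact p.Prime]

theorem Padic.natCast_prime_pos : (0 : ℝ) < p :=
  Nat.cast_pos.2 (Fact.out : p.Prime).pos

theorem Padic.one_lt_natCast_prime : (1 : ℝ) < p :=
  Nat.one_lt_cast.2 (Fact.out : p.Prime).one_lt

theorem Padic.closedBall_zpow_succ_eq_iUnion (k : ℤ) :
    closedBall (0 : ℚ_[p]) ((p : ℝ) ^ (k + 1)) =
      ⋃ j : Fin p, closedBall ((j : ℕ) * (p : ℚ_[p]) ^ (-(k + 1))) ((p : ℝ) ^ k) := by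
  have hp0 : (0 : ℝ) < p := Padic.natCast_prime_pos
  have hpQ : (p : ℚ_[p]) ≠ 0 := by exact_mod_cast (Fact.out : p.Prime).ne_zero
  ext y
  simp only [mem_iUnion, mem_closedBall, dist_eq_norm, sub_zero]
  constructor
  · intro hy
    have hu : ‖y * (p : ℚ_[p]) ^ (k + 1)‖ ≤ 1 := by
      rw [norm_mul, Padic.norm_p_zpow]
      calc ‖y‖ * (p : ℝ) ^ (-(k + 1)) ≤ (p : ℝ) ^ (k + 1) * (p : ℝ) ^ (-(k + 1)) := by gcongr
        _ = 1 := by rw [← zpow_add₀ hp0.ne']; simp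
    let u : ℤ_[p] := ⟨_, hu⟩
    refine ⟨⟨u.zmodRepr, u.zmodRepr_lt_p⟩, ?_⟩
    have h1 : ‖u - u.zmodRepr‖ ≤ (p : ℝ) ^ (-1 : ℤ) := by
      rw [PadicInt.norm_le_pow_iff_norm_lt_pow_add_one]
      simpa using u.norm_sub_zmodRepr_lt_one
    have h2 : y - (u.zmodRepr : ℚ_[p]) * (p : ℚ_[p]) ^ (-(k + 1)) =
        ((u - u.zmodRepr : ℤ_[p]) : ℚ_[p]) * (p : ℚ_[p]) ^ (-(k + 1)) := by
      have : (u : ℚ_[p]) = y * (p : ℚ_[p]) ^ (k + 1) := rfl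
      push_cast
      rw [this, sub_mul, mul_assoc, ← zpow_add₀ hpQ]
      simp
    rw [h2, norm_mul, Padic.norm_p_zpow, neg_neg, ← PadicInt.norm_def]
    calc _ ≤ (p : ℝ) ^ (-1 : ℤ) * (p : ℝ) ^ (k + 1) := by gcongr
      _ = (p : ℝ) ^ k := by rw [← zpow_add₀ hp0.ne']; ring_nf
  · rintro ⟨j, hj⟩
    have h1 : ‖((j : ℕ) : ℚ_[p]) * (p : ℚ_[p]) ^ (-(k + 1))‖ ≤ (p : ℝ) ^ (k + 1) := by
      rw [norm_mul, Padic.norm_p_zpow, neg_neg]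
      exact mul_le_of_le_one_left (by positivity)
        (by simpa using Padic.norm_int_le_one (p := p) (j : ℤ))
    have h2 : ‖y - ((j : ℕ) : ℚ_[p]) * (p : ℚ_[p]) ^ (-(k + 1))‖ ≤ (p : ℝ) ^ (k + 1) :=
      hj.trans (zpow_le_zpow_right₀ Padic.one_lt_natCast_prime.le (by omega))
    have := (Padic.nonarchimedean (y - ((j : ℕ) : ℚ_[p]) * (p : ℚ_[p]) ^ (-(k + 1)))
      (((j : ℕ) : ℚ_[p]) * (p : ℚ_[p]) ^ (-(k + 1)))).trans (max_le h2 h1)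
    simpa using this

theorem Padic.pairwise_disjoint_closedBall_zpow (k : ℤ) :
    Pairwise (Function.onFun Disjoint fun j : Fin p =>
      closedBall ((j : ℕ) * (p : ℚ_[p]) ^ (-(k + 1))) ((p : ℝ) ^ k)) := by
  have hp0 : (0 : ℝ) < p := Padic.natCast_prime_pos
  intro i j hij
  refine Set.disjoint_left.2 fun y hi hj => hij ?_
  rw [mem_closedBall, dist_eq_norm] at hi hj
  have h := (Padic.nonarchimedean (y - ((j : ℕ) : ℚ_[p]) * (p : ℚ_[p]) ^ (-(k + 1)))
    (-(y - ((i : ℕ) : ℚ_[p]) * (p : ℚ_[p]) ^ (-(k + 1))))).trans (max_le hj (by rwa [norm_neg]))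
  have h2 : y - ((j : ℕ) : ℚ_[p]) * (p : ℚ_[p]) ^ (-(k + 1)) +
      -(y - ((i : ℕ) : ℚ_[p]) * (p : ℚ_[p]) ^ (-(k + 1))) =
      (((i : ℤ) - (j : ℤ) : ℤ) : ℚ_[p]) * (p : ℚ_[p]) ^ (-(k + 1)) := by
    push_cast; ring
  rw [h2, norm_mul, Padic.norm_p_zpow, neg_neg, zpow_add_one₀ hp0.ne'] at h
  have h3 : ‖(((i : ℤ) - (j : ℤ) : ℤ) : ℚ_[p])‖ < 1 := by
    have hk : (0 : ℝ) < (p : ℝ) ^ k := by positivity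
    have h1p : (1 : ℝ) < p := Padic.one_lt_natCast_prime
    by_contra! hge
    nlinarith [mul_le_mul_of_nonneg_right hge (mul_pos hk hp0).le, mul_lt_mul_of_pos_left h1p hk]
  rw [Padic.norm_intCast_lt_one_iff] at h3
  have h4 := Int.eq_zero_of_abs_lt_dvd h3 (by rw [abs_lt]; omega)
  ext; omega

theorem Padic.ofReal_zpow_mul_ofReal_zpow_neg (r : ℤ) :
    ENNReal.ofReal ((p : ℝ) ^ r) * ENNReal.ofReal ((p : ℝ) ^ (-r)) = 1 := by
  have hp0 : (0 : ℝ) < p := Padic.natCast_prime_pos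
  rw [← ENNReal.ofReal_mul (by positivity), ← zpow_add₀ hp0.ne']
  simp

/-- The indicator of `B_{-r}` divided by its volume `p ^ (-r)`. -/
noncomputable def normalizedBall (p : ℕ) [Fact p.Prime] (r : ℤ) (x : ℚ_[p]) : ℝ≥0∞ :=
  ENNReal.ofReal ((p : ℝ) ^ r) * (closedBall 0 ((p : ℝ) ^ (-r))).indicator 1 x

theorem normalizedBall_mul_sub {r s : ℤ} (h : r ≤ s) (x z : ℚ_[p]) :
    normalizedBall p r x * normalizedBall p s (z - x) =
      normalizedBall p r z * normalizedBall p s (z - x) := by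
  unfold normalizedBall
  by_cases hx : z - x ∈ closedBall (0 : ℚ_[p]) ((p : ℝ) ^ (-s))
  · rw [mem_closedBall_zero_iff] at hx
    have hle : ‖z - x‖ ≤ (p : ℝ) ^ (-r) :=
      hx.trans (zpow_le_zpow_right₀ Padic.one_lt_natCast_prime.le (by omega))
    have hiff : x ∈ closedBall (0 : ℚ_[p]) ((p : ℝ) ^ (-r)) ↔
        z ∈ closedBall (0 : ℚ_[p]) ((p : ℝ) ^ (-r)) := by
      simp only [mem_closedBall_zero_iff]
      constructor
      · intro hx'
        simpa using (Padic.nonarchimedean (z - x) x).trans (max_le hle hx')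
      · intro hz
        simpa using (Padic.nonarchimedean (-(z - x)) z).trans (max_le (by rwa [norm_neg]) hz)
    by_cases hz : z ∈ closedBall (0 : ℚ_[p]) ((p : ℝ) ^ (-r))
    · rw [indicator_of_mem hz, indicator_of_mem (hiff.2 hz), Pi.one_apply, Pi.one_apply]
    · rw [indicator_of_notMem hz, indicator_of_notMem (hiff.not.2 hz)]
  · simp only [indicator_of_notMem hx, mul_zero]

variable [MeasurableSpace ℚ_[p]] [BorelSpace ℚ_[p]] (μ : Measure ℚ_[p])

theorem Padic.measure_closedBall_center [μ.IsAddHaarMeasure] (x : ℚ_[p]) (r : ℝ) :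
    μ (closedBall x r) = μ (closedBall 0 r) := by
  rw [← measure_preimage_add μ (-x) (closedBall 0 r)]
  congr 1
  ext y
  simp [dist_eq_norm, neg_add_eq_sub]

theorem Padic.measure_closedBall_zpow_succ [μ.IsAddHaarMeasure] (k : ℤ) :
    μ (closedBall 0 ((p : ℝ) ^ (k + 1))) = p * μ (closedBall 0 ((p : ℝ) ^ k)) := by
  rw [Padic.closedBall_zpow_succ_eq_iUnion,
    measure_iUnion (Padic.pairwise_disjoint_closedBall_zpow k) fun _ => measurableSet_closedBall]
  simp [Padic.measure_closedBall_center μ]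

theorem Padic.measure_closedBall_zpow [μ.IsAddHaarMeasure]
    (hμ : μ (closedBall 0 1) = 1) (k : ℤ) (x : ℚ_[p]) :
    μ (closedBall x ((p : ℝ) ^ k)) = ENNReal.ofReal ((p : ℝ) ^ k) := by
  have hp0 : (0 : ℝ) < p := Padic.natCast_prime_pos
  have hpE : (p : ℝ≥0∞) ≠ 0 := by exact_mod_cast (Fact.out : p.Prime).ne_zero
  have hstep (k : ℤ) : ENNReal.ofReal ((p : ℝ) ^ (k + 1)) = p * ENNReal.ofReal ((p : ℝ) ^ k) := by
    rw [zpow_add_one₀ hp0.ne', mul_comm, ENNReal.ofReal_mul hp0.le, ENNReal.ofReal_natCast]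
  rw [Padic.measure_closedBall_center]
  induction k with
  | zero => simpa using hμ
  | succ n ih => rw [Padic.measure_closedBall_zpow_succ, ih, hstep]
  | pred n ih =>
    have h1 := Padic.measure_closedBall_zpow_succ μ (-(n : ℤ) - 1)
    have h2 := hstep (-(n : ℤ) - 1)
    rw [sub_add_cancel] at h1 h2
    rw [ih, h2] at h1
    exact ((ENNReal.mul_right_inj hpE (ENNReal.natCast_ne_top p)).1 h1).symm

theorem measurable_normalizedBall (r : ℤ) : Measurable (normalizedBall p r) :=
  (measurable_one.indicator measurableSet_closedBall).const_mul _

variable {μ}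

theorem lintegral_normalizedBall [μ.IsAddHaarMeasure] (hμ : μ (closedBall 0 1) = 1) (r : ℤ) :
    ∫⁻ x, normalizedBall p r x ∂μ = 1 := by
  unfold normalizedBall
  rw [lintegral_const_mul _ (measurable_one.indicator measurableSet_closedBall),
    lintegral_indicator_one measurableSet_closedBall, Padic.measure_closedBall_zpow μ hμ,
    Padic.ofReal_zpow_mul_ofReal_zpow_neg]

theorem lintegral_normalizedBall_mul_sub [μ.IsAddHaarMeasure] (hμ : μ (closedBall 0 1) = 1)
    (r s : ℤ) (z : ℚ_[p]) :
    ∫⁻ x, normalizedBall p r x * normalizedBall p s (z - x) ∂μ = normalizedBall p (min r s) z := by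
  have key {r s : ℤ} (h : r ≤ s) :
      ∫⁻ x, normalizedBall p r x * normalizedBall p s (z - x) ∂μ = normalizedBall p r z := by
    simp_rw [normalizedBall_mul_sub h]
    have hm : Measurable fun x => normalizedBall p s (z - x) :=
      (measurable_normalizedBall s).comp (measurable_id.const_sub z)
    rw [lintegral_const_mul _ hm,
      lintegral_sub_left_eq_self, lintegral_normalizedBall hμ, mul_one]
  rcases le_total r s with h | h
  · rw [min_eq_left h, key h]
  · rw [min_eq_right h, ← key h,
      ← lintegral_sub_left_eq_self (fun x => normalizedBall p r x * normalizedBall p s (z - x)) z]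
    simp_rw [_root_.sub_sub_cancel, mul_comm]

end Balls

section Summation

theorem tsum_ofReal_sub_succ {f : ℕ → ℝ} (hf : Antitone f) (h0 : Tendsto f atTop (𝓝 0)) :
    ∑' n, ENNReal.ofReal (f n - f (n + 1)) = ENNReal.ofReal (f 0) := by
  have hnn (n : ℕ) : 0 ≤ f n - f (n + 1) := sub_nonneg.2 (hf n.le_succ)
  have hs : HasSum (fun n => f n - f (n + 1)) (f 0) := by
    rw [hasSum_iff_tendsto_nat_of_nonneg hnn]
    simp_rw [Finset.sum_range_sub']
    simpa using tendsto_const_nhds.sub h0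
  rw [← ENNReal.ofReal_tsum_of_nonneg hnn hs.summable, hs.tsum_eq]

variable {E F : ℤ → ℝ}

theorem tsum_ite_le_ofReal_sub_succ (hE : Antitone E) (h0 : Tendsto E atTop (𝓝 0)) (m : ℤ) :
    ∑' s, (if m ≤ s then ENNReal.ofReal (E s - E (s + 1)) else 0) = ENNReal.ofReal (E m) := by
  have hinj : Function.Injective fun n : ℕ => m + (n : ℤ) := fun a b h => by
    simpa using h
  rw [← hinj.tsum_eq]
  · have ht : Tendsto (fun n : ℕ => E (m + n)) atTop (𝓝 0) :=
      h0.comp (tendsto_atTop_add_const_left _ _ tendsto_natCast_atTop_atTop)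
    have ha : Antitone fun n : ℕ => E (m + n) := fun a b hab => hE (by simpa using hab)
    simpa [add_assoc] using tsum_ofReal_sub_succ ha ht
  · intro s hs
    have hms : m ≤ s := by
      by_contra h
      simp [h] at hs
    exact ⟨(s - m).toNat, by simp [hms]⟩

theorem tsum_ofReal_sub_succ_le {c : ℝ} (hE : Antitone E) (h0 : Tendsto E atTop (𝓝 0))
    (hc : ∀ r, E r ≤ c) : ∑' r, ENNReal.ofReal (E r - E (r + 1)) ≤ ENNReal.ofReal c := by
  rw [ENNReal.tsum_eq_iSup_sum]
  refine iSup_le fun S => ?_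
  obtain ⟨m, hm⟩ := S.bddBelow
  calc ∑ r ∈ S, ENNReal.ofReal (E r - E (r + 1))
      = ∑ r ∈ S, (if m ≤ r then ENNReal.ofReal (E r - E (r + 1)) else 0) :=
        Finset.sum_congr rfl fun r hr => by rw [if_pos (hm hr)]
    _ ≤ ENNReal.ofReal (E m) :=
        (ENNReal.sum_le_tsum S).trans_eq (tsum_ite_le_ofReal_sub_succ hE h0 m)
    _ ≤ ENNReal.ofReal c := ENNReal.ofReal_le_ofReal (hc m)

theorem tsum_tsum_mul_min (hE : Antitone E) (hE0 : Tendsto E atTop (𝓝 0))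
    (hF : Antitone F) (hF0 : Tendsto F atTop (𝓝 0)) (u : ℤ → ℝ≥0∞) :
    ∑' r, ∑' s, ENNReal.ofReal (E r - E (r + 1)) * ENNReal.ofReal (F s - F (s + 1)) *
        u (min r s) =
      ∑' m, ENNReal.ofReal (E m * F m - E (m + 1) * F (m + 1)) * u m := by
  have hEn (r : ℤ) : 0 ≤ E r := hE.le_of_tendsto hE0 r
  have hFn (r : ℤ) : 0 ≤ F r := hF.le_of_tendsto hF0 r
  set A : ℤ → ℝ≥0∞ := fun r => ENNReal.ofReal (E r - E (r + 1)) with hA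
  set B : ℤ → ℝ≥0∞ := fun r => ENNReal.ofReal (F r - F (r + 1)) with hB
  have hsplit (r s : ℤ) : A r * B s * u (min r s) =
      A r * u r * (if r ≤ s then B s else 0) + B s * u s * (if s + 1 ≤ r then A r else 0) := by
    rcases le_or_gt r s with h | h
    · rw [min_eq_left h, if_pos h, if_neg (by omega)]
      ring
    · rw [min_eq_right h.le, if_neg (by omega), if_pos (by omega)]
      ring
  have h1 (r : ℤ) : ∑' s, A r * u r * (if r ≤ s then B s else 0) =
      A r * u r * ENNReal.ofReal (F r) := by
    rw [ENNReal.tsum_mul_left, tsum_ite_le_ofReal_sub_succ hF hF0]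
  have h2 (s : ℤ) : ∑' r, B s * u s * (if s + 1 ≤ r then A r else 0) =
      B s * u s * ENNReal.ofReal (E (s + 1)) := by
    rw [ENNReal.tsum_mul_left, tsum_ite_le_ofReal_sub_succ hE hE0]
  calc ∑' r, ∑' s, A r * B s * u (min r s)
      = ∑' r, ∑' s, A r * u r * (if r ≤ s then B s else 0) +
          ∑' s, ∑' r, B s * u s * (if s + 1 ≤ r then A r else 0) := by
        simp_rw [hsplit, ENNReal.tsum_add]
        congr 1
        exact ENNReal.tsum_comm
    _ = ∑' m, (A m * u m * ENNReal.ofReal (F m) + B m * u m * ENNReal.ofReal (E (m + 1))) := by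
        simp_rw [h1, h2, ENNReal.tsum_add]
    _ = _ := by
        refine tsum_congr fun m => ?_
        have hEm : 0 ≤ E m - E (m + 1) := sub_nonneg.2 (hE (by omega))
        have hFm : 0 ≤ F m - F (m + 1) := sub_nonneg.2 (hF (by omega))
        have hsum : E m * F m - E (m + 1) * F (m + 1) =
            (E m - E (m + 1)) * F m + (F m - F (m + 1)) * E (m + 1) := by ring
        rw [hsum, ENNReal.ofReal_add (mul_nonneg hEm (hFn m)) (mul_nonneg hFm (hEn _)),
          ENNReal.ofReal_mul hEm, ENNReal.ofReal_mul hFm]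
        ring

end Summation

section RadialSeries

variable {p : ℕ} [Fact p.Prime]

/-- The superposition of normalized balls `B_{-r}` with weights `E r - E (r + 1)`. -/
noncomputable def radialSeries (p : ℕ) [Fact p.Prime] (E : ℤ → ℝ) (x : ℚ_[p]) : ℝ≥0∞ :=
  ∑' r, ENNReal.ofReal (E r - E (r + 1)) * normalizedBall p r x

variable [MeasurableSpace ℚ_[p]] [BorelSpace ℚ_[p]] {μ : Measure ℚ_[p]} {E F : ℤ → ℝ}

theorem measurable_radialSeries : Measurable (radialSeries p E) :=
  Measurable.tsum fun r => (measurable_normalizedBall r).const_mul _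

theorem ae_radialSeries_lt_top [μ.IsAddHaarMeasure] (hμ : μ (closedBall 0 1) = 1)
    {c : ℝ} (hE : Antitone E) (h0 : Tendsto E atTop (𝓝 0)) (hc : ∀ r, E r ≤ c) :
    ∀ᵐ x ∂μ, radialSeries p E x < ∞ := by
  refine ae_lt_top measurable_radialSeries (ne_top_of_le_ne_top (ENNReal.ofReal_ne_top (r := c)) ?_)
  unfold radialSeries
  rw [lintegral_tsum fun r => ((measurable_normalizedBall r).const_mul _).aemeasurable]
  simp_rw [lintegral_const_mul _ (measurable_normalizedBall _), lintegral_normalizedBall hμ, mul_one]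
  exact tsum_ofReal_sub_succ_le hE h0 hc

theorem lintegral_radialSeries_mul_sub [μ.IsAddHaarMeasure] (hμ : μ (closedBall 0 1) = 1)
    (hE : Antitone E) (hE0 : Tendsto E atTop (𝓝 0))
    (hF : Antitone F) (hF0 : Tendsto F atTop (𝓝 0)) (z : ℚ_[p]) :
    ∫⁻ x, radialSeries p E x * radialSeries p F (z - x) ∂μ =
      radialSeries p (fun r => E r * F r) z := by
  have hm (r s : ℤ) : Measurable fun x => normalizedBall p r x * normalizedBall p s (z - x) :=
    (measurable_normalizedBall r).mul
      ((measurable_normalizedBall s).comp (measurable_id.const_sub z))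
  have hexp (x : ℚ_[p]) : radialSeries p E x * radialSeries p F (z - x) =
      ∑' r, ∑' s, ENNReal.ofReal (E r - E (r + 1)) * ENNReal.ofReal (F s - F (s + 1)) *
        (normalizedBall p r x * normalizedBall p s (z - x)) := by
    unfold radialSeries
    rw [← ENNReal.tsum_mul_right]
    refine tsum_congr fun r => ?_
    rw [← ENNReal.tsum_mul_left]
    exact tsum_congr fun s => by ring
  simp_rw [hexp]
  rw [lintegral_tsum fun r => (Measurable.tsum fun s => (hm r s).const_mul _).aemeasurable]
  simp_rw [fun r => lintegral_tsum (μ := μ) fun s => ((hm r s).const_mul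
    (ENNReal.ofReal (E r - E (r + 1)) * ENNReal.ofReal (F s - F (s + 1)))).aemeasurable,
    lintegral_const_mul _ (hm _ _), lintegral_normalizedBall_mul_sub hμ]
  exact tsum_tsum_mul_min hE hE0 hF hF0 fun m => normalizedBall p m z

end RadialSeries

section HeatKernel

/-- The survival weight `exp (-σ t p ^ (r b))`, a function of the level `r`. -/
noncomputable def heatWeight (p : ℕ) (σ b t : ℝ) (r : ℤ) : ℝ :=
  Real.exp (-(σ * t * (p : ℝ) ^ ((r : ℝ) * b)))

variable {p : ℕ} {σ b t : ℝ}

theorem heatWeight_le_one (hσ : 0 < σ) (ht : 0 < t) (r : ℤ) : heatWeight p σ b t r ≤ 1 := by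
  unfold heatWeight
  rw [Real.exp_le_one_iff, neg_nonpos]
  positivity

theorem heatWeight_mul (t t' : ℝ) (r : ℤ) :
    heatWeight p σ b t r * heatWeight p σ b t' r = heatWeight p σ b (t + t') r := by
  unfold heatWeight
  rw [← Real.exp_add]
  ring_nf

variable [Fact p.Prime]

theorem antitone_heatWeight (hσ : 0 < σ) (hb : 0 < b) (ht : 0 < t) :
    Antitone (heatWeight p σ b t) := by
  intro r s hrs
  have h1 : (1 : ℝ) ≤ p := Padic.one_lt_natCast_prime.le
  have hrs' : (r : ℝ) ≤ s := Int.cast_le.2 hrs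
  unfold heatWeight
  gcongr

theorem tendsto_heatWeight (hσ : 0 < σ) (hb : 0 < b) (ht : 0 < t) :
    Tendsto (heatWeight p σ b t) atTop (𝓝 0) := by
  have h1 : Tendsto (fun r : ℤ => (r : ℝ) * b) atTop atTop :=
    tendsto_intCast_atTop_atTop.atTop_mul_const hb
  have h2 : Tendsto (fun r : ℤ => (p : ℝ) ^ ((r : ℝ) * b)) atTop atTop :=
    (tendsto_rpow_atTop_of_base_gt_one _ Padic.one_lt_natCast_prime).comp h1
  exact Real.tendsto_exp_neg_atTop_nhds_zero.comp (h2.const_mul_atTop (mul_pos hσ ht))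

theorem rho_eq_toReal_radialSeries (hσ : 0 < σ) (hb : 0 < b) (ht : 0 < t) (x : ℚ_[p]) :
    rho p σ b t x = (radialSeries p (heatWeight p σ b t) x).toReal := by
  have hind (r : ℤ) : (closedBall (0 : ℚ_[p]) ((p : ℝ) ^ (-r))).indicator (1 : ℚ_[p] → ℝ≥0∞) x
      ≠ ∞ := by
    by_cases hx : x ∈ closedBall (0 : ℚ_[p]) ((p : ℝ) ^ (-r))
    · rw [indicator_of_mem hx]
      exact ENNReal.one_ne_top
    · rw [indicator_of_notMem hx]
      exact ENNReal.zero_ne_top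
  unfold radialSeries rho normalizedBall
  rw [ENNReal.tsum_toReal_eq fun r => ENNReal.mul_ne_top ENNReal.ofReal_ne_top
    (ENNReal.mul_ne_top ENNReal.ofReal_ne_top (hind r))]
  refine tsum_congr fun r => ?_
  have hw : 0 ≤ heatWeight p σ b t r - heatWeight p σ b t (r + 1) :=
    sub_nonneg.2 (antitone_heatWeight hσ hb ht (by omega))
  rw [ENNReal.toReal_mul, ENNReal.toReal_mul, ENNReal.toReal_ofReal hw,
    ENNReal.toReal_ofReal (by positivity), mul_assoc]
  congr 2
  · simp [heatWeight]
  · by_cases hx : ‖x‖ ≤ (p : ℝ) ^ (-r)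
    · rw [indicator_of_mem (mem_closedBall_zero_iff.2 hx), Pi.one_apply, ENNReal.toReal_one]
      exact indicator_of_mem (s := {y : ℚ_[p] | ‖y‖ ≤ (p : ℝ) ^ (-r)}) hx _
    · rw [indicator_of_notMem (mem_closedBall_zero_iff.not.2 hx), ENNReal.toReal_zero]
      exact indicator_of_notMem (s := {y : ℚ_[p] | ‖y‖ ≤ (p : ℝ) ^ (-r)}) hx _

end HeatKernel

/-- Chapman–Kolmogorov identity for the p-adic heat kernel: for all
`t, t' > 0` and every `z ∈ ℚ_p`, `∫_{ℚ_p} ρ(t,x)·ρ(t',z−x) dμ(x) = ρ(t+t',z)`, where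
`μ` is the Haar measure on `ℚ_p` normalized so that `μ(ℤ_p) = 1`. -/
theorem exit_prob_statement_4 (p : ℕ) [Fact p.Prime]
    [MeasurableSpace ℚ_[p]] [BorelSpace ℚ_[p]]
    (μ : Measure ℚ_[p]) [μ.IsAddHaarMeasure]
    (hμ : μ {x : ℚ_[p] | ‖x‖ ≤ 1} = 1)
    (σ b : ℝ) (hσ : 0 < σ) (hb : 0 < b)
    (t t' : ℝ) (ht : 0 < t) (ht' : 0 < t') (z : ℚ_[p]) :
    ∫ x, rho p σ b t x * rho p σ b t' (z - x) ∂μ = rho p σ b (t + t') z := by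
  have hμ' : μ (closedBall 0 1) = 1 := by
    rw [← hμ]
    congr 1
    ext x
    simp
  have hE := antitone_heatWeight (p := p) hσ hb ht
  have hE0 := tendsto_heatWeight (p := p) hσ hb ht
  have hF := antitone_heatWeight (p := p) hσ hb ht'
  have hF0 := tendsto_heatWeight (p := p) hσ hb ht'
  simp_rw [rho_eq_toReal_radialSeries hσ hb ht, rho_eq_toReal_radialSeries hσ hb ht',
    rho_eq_toReal_radialSeries hσ hb (add_pos ht ht'), ← ENNReal.toReal_mul]
  rw [integral_toReal]
  · simp_rw [lintegral_radialSeries_mul_sub hμ' hE hE0 hF hF0, heatWeight_mul]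
  · exact (measurable_radialSeries.mul
      (measurable_radialSeries.comp (measurable_id.const_sub z))).aemeasurable
  · have h1 := ae_radialSeries_lt_top hμ' hE hE0 (heatWeight_le_one hσ ht)
    have h2 := (quasiMeasurePreserving_sub_left μ z).ae
      (ae_radialSeries_lt_top hμ' hF hF0 (heatWeight_le_one hσ ht'))
    filter_upwards [h1, h2] with x hx hx' using ENNReal.mul_lt_top hx hx'
end

section
/- Fix an integer a and define B : [0,∞) → ℝ by B(0) = 1 and B(t) = ∫_{B_a} ρ(t,x) dμ(x) for t > 0. Then B has right-derivative at 0 equal to −σ·α·p^{−ab}; that is, lim_{t→0+} (B(t) − 1)/t = −σ·α·p^{−ab}, where α := 1 − (p^b − 1)/(p^{b+1} − 1). -/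
open MeasureTheory Filter

lemma tendsto_exp_neg_mul_sub_one_div (c : ℝ) :
    Tendsto (fun t : ℝ => (Real.exp (-(c * t)) - 1) / t) (nhdsWithin 0 (Set.Ioi 0))
      (nhds (-c)) := by
  have h : HasDerivAt (fun t : ℝ => Real.exp (-(c * t))) (-c) 0 := by
    simpa using (((hasDerivAt_id (0 : ℝ)).const_mul c).neg).exp
  have h' := h.tendsto_slope_zero_right
  refine h'.congr fun t => ?_
  simp [div_eq_inv_mul]

lemma exp_neg_sub_exp_neg_le {x y : ℝ} (hx : 0 ≤ x) (hxy : x ≤ y) :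
    Real.exp (-x) - Real.exp (-y) ≤ y - x := by
  have h1 : Real.exp (-y) = Real.exp (-x) * Real.exp (-(y - x)) := by
    rw [← Real.exp_add]; congr 1; ring
  have h2 : 1 - (y - x) ≤ Real.exp (-(y - x)) := Real.one_sub_le_exp_neg _
  have h3 : Real.exp (-x) ≤ 1 := Real.exp_le_one_iff.2 (by linarith)
  have h4 := Real.exp_pos (-x)
  rw [h1]
  nlinarith [mul_le_mul_of_nonneg_left h2 h4.le, mul_le_mul_of_nonneg_right h3 (sub_nonneg.2 hxy)]

/-- The right derivative at `0` of the series obtained by integrating the fundamental solution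
over a ball. -/
lemma tendsto_expSeries_sub_one_div {C v q : ℝ} (hC : 0 < C) (hv : 0 < v) (hv1 : v < 1)
    (hq : 0 < q) (hq1 : q < 1) :
    Tendsto (fun t : ℝ => (Real.exp (-(C * t)) +
        ∑' k : ℕ, (Real.exp (-(C * t * v ^ (k + 1))) - Real.exp (-(C * t * v ^ k))) *
          q ^ (k + 1) - 1) / t)
      (nhdsWithin 0 (Set.Ioi 0)) (nhds (-(C * (1 - q * (1 - v) / (1 - q * v))))) := by
  have hqv : q * v < 1 := by nlinarith
  have hsum : ∑' k : ℕ, (C * v ^ k - C * v ^ (k + 1)) * q ^ (k + 1) =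
      C * (q * (1 - v) / (1 - q * v)) := by
    have h := (hasSum_geometric_of_lt_one (by positivity) hqv).mul_left (C * (q * (1 - v)))
    rw [← mul_div_assoc, div_eq_mul_inv, ← h.tsum_eq]
    refine tsum_congr fun k => ?_
    rw [mul_pow]; ring
  have hlim : Tendsto (fun t : ℝ => ∑' k : ℕ,
      (Real.exp (-(C * t * v ^ (k + 1))) - Real.exp (-(C * t * v ^ k))) * q ^ (k + 1) / t)
      (nhdsWithin 0 (Set.Ioi 0)) (nhds (C * (q * (1 - v) / (1 - q * v)))) := by
    rw [← hsum]
    refine tendsto_tsum_of_dominated_convergence (bound := fun k => C * q ^ (k + 1)) ?_ ?_ ?_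
    · exact ((summable_nat_add_iff 1).2 (summable_geometric_of_lt_one hq.le hq1)).mul_left C
    · intro k
      have h := ((tendsto_exp_neg_mul_sub_one_div (C * v ^ (k + 1))).sub
        (tendsto_exp_neg_mul_sub_one_div (C * v ^ k))).mul_const (q ^ (k + 1))
      rw [neg_sub_neg] at h
      refine h.congr fun t => ?_
      rw [mul_right_comm C (v ^ (k + 1)), mul_right_comm C (v ^ k)]
      ring
    · filter_upwards [self_mem_nhdsWithin] with t (ht : 0 < t) k
      have hvk : v ^ (k + 1) ≤ v ^ k := pow_le_pow_of_le_one hv.le hv1.le (Nat.le_succ k)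
      have hle : C * t * v ^ (k + 1) ≤ C * t * v ^ k := by gcongr
      have h1 := exp_neg_sub_exp_neg_le (by positivity) hle
      have h0 : 0 ≤ Real.exp (-(C * t * v ^ (k + 1))) - Real.exp (-(C * t * v ^ k)) :=
        sub_nonneg.2 (Real.exp_le_exp.2 (neg_le_neg hle))
      have h2 : C * t * v ^ k - C * t * v ^ (k + 1) ≤ C * t := by
        have := pow_le_one₀ (n := k) hv.le hv1.le
        have h3 : 0 ≤ C * t * v ^ (k + 1) := by positivity
        have h4 : C * t * v ^ k ≤ C * t * 1 := by gcongr
        linarith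
      rw [Real.norm_of_nonneg (by positivity), div_le_iff₀ ht]
      calc _ ≤ C * t * q ^ (k + 1) := by gcongr; exact h1.trans h2
        _ = _ := by ring
  have h := (tendsto_exp_neg_mul_sub_one_div C).add hlim
  rw [show -(C * (1 - q * (1 - v) / (1 - q * v))) = -C + C * (q * (1 - v) / (1 - q * v)) by ring]
  refine h.congr fun t => ?_
  rw [tsum_div_const]
  ring

lemma summable_expSeries {s v q : ℝ} (hs : 0 < s) (hv : 0 < v) (hq : 0 < q) (hq1 : q < 1) :
    Summable fun k : ℕ =>
      (Real.exp (-(s * v ^ (k + 1))) - Real.exp (-(s * v ^ k))) * q ^ (k + 1) := by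
  refine Summable.of_norm_bounded
    ((summable_nat_add_iff 1).2 (summable_geometric_of_lt_one hq.le hq1)) fun k => ?_
  rw [norm_mul, Real.norm_of_nonneg (by positivity : 0 ≤ q ^ (k + 1))]
  refine mul_le_of_le_one_left (by positivity) ?_
  have h1 : Real.exp (-(s * v ^ (k + 1))) ≤ 1 :=
    Real.exp_le_one_iff.2 (neg_nonpos.2 (by positivity))
  have h2 : Real.exp (-(s * v ^ k)) ≤ 1 := Real.exp_le_one_iff.2 (neg_nonpos.2 (by positivity))
  rw [Real.norm_eq_abs, abs_le]
  constructor <;> linarith [Real.exp_pos (-(s * v ^ (k + 1))), Real.exp_pos (-(s * v ^ k))]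

lemma hasSum_int_exp_sub_exp {s u w : ℝ} (hs : 0 < s) (hu : 1 < u) (hw : 1 < w) :
    HasSum (fun n : ℤ => (Real.exp (-(s * u ^ n)) - Real.exp (-(s * u ^ (n + 1)))) *
        w ^ (min 0 n))
      (Real.exp (-s) + ∑' k : ℕ,
        (Real.exp (-(s * u⁻¹ ^ (k + 1))) - Real.exp (-(s * u⁻¹ ^ k))) * w⁻¹ ^ (k + 1)) := by
  have hu0 : 0 < u := by linarith
  have hw0 : 0 < w := by linarith
  refine HasSum.of_nat_of_neg_add_one ?_ ?_
  · have hmin : ∀ n : ℕ, min (0 : ℤ) n = 0 := fun n => by omega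
    simp only [hmin, zpow_zero, mul_one]
    rw [hasSum_iff_tendsto_nat_of_nonneg]
    · have hlim : Tendsto (fun n : ℕ => Real.exp (-(s * u ^ n))) atTop (nhds 0) :=
        Real.tendsto_exp_neg_atTop_nhds_zero.comp
          ((tendsto_pow_atTop_atTop_of_one_lt hu).const_mul_atTop hs)
      have h := hlim.const_sub (Real.exp (-s))
      rw [sub_zero] at h
      refine h.congr fun n => ?_
      have := Finset.sum_range_sub' (fun k : ℕ => Real.exp (-(s * u ^ k))) n
      rw [pow_zero, mul_one] at this
      rw [← this]
      refine Finset.sum_congr rfl fun k _ => ?_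
      norm_cast
    · intro n
      refine sub_nonneg.2 (Real.exp_le_exp.2 (neg_le_neg ?_))
      gcongr
      · exact hu.le
      · omega
  · have h := (summable_expSeries hs (inv_pos.2 hu0) (inv_pos.2 hw0)
      (inv_lt_one_of_one_lt₀ hw)).hasSum
    convert h using 2 with k
    have h1 : u ^ (-((k : ℤ) + 1)) = u⁻¹ ^ (k + 1) := by
      rw [zpow_neg, inv_pow]; norm_cast
    have h2 : u ^ (-((k : ℤ) + 1) + 1) = u⁻¹ ^ k := by
      rw [neg_add, neg_add_cancel_right, zpow_neg, inv_pow]; norm_cast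
    have h3 : w ^ (min 0 (-((k : ℤ) + 1))) = w⁻¹ ^ (k + 1) := by
      rw [min_eq_right (by omega), zpow_neg, inv_pow]; norm_cast
    rw [h1, h2, h3]

lemma Padic.measure_closedBall_succ (p : ℕ) [Fact p.Prime]
    [MeasurableSpace ℚ_[p]] [BorelSpace ℚ_[p]] (μ : Measure ℚ_[p]) [μ.IsAddHaarMeasure] (m : ℤ) :
    μ {x : ℚ_[p] | ‖x‖ ≤ (p : ℝ) ^ (m + 1)} = p * μ {x : ℚ_[p] | ‖x‖ ≤ (p : ℝ) ^ m} := by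
  have hp : (0 : ℝ) < p := by exact_mod_cast (Fact.out : p.Prime).pos
  have hp0 : (p : ℚ_[p]) ≠ 0 := by exact_mod_cast (Fact.out : p.Prime).ne_zero
  set c : ℚ_[p] := (p : ℚ_[p]) ^ (-(m + 1)) with hc
  have hc0 : c ≠ 0 := zpow_ne_zero _ hp0
  have hcn : ‖c‖ = (p : ℝ) ^ (m + 1) := by rw [hc, Padic.norm_p_zpow, neg_neg]
  have hstep : (p : ℝ) ^ m = (p : ℝ) ^ (m + 1) * (p : ℝ)⁻¹ := by
    rw [zpow_add_one₀ hp.ne', mul_inv_cancel_right₀ hp.ne']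
  have hunion : {x : ℚ_[p] | ‖x‖ ≤ (p : ℝ) ^ (m + 1)} =
      ⋃ i : Fin p, (fun x => -(c * (i : ℕ)) + x) ⁻¹' {x : ℚ_[p] | ‖x‖ ≤ (p : ℝ) ^ m} := by
    ext x
    simp only [Set.mem_ofPred_eq, Set.mem_iUnion, Set.mem_preimage]
    constructor
    · intro hx
      have hy : ‖c⁻¹ * x‖ ≤ 1 := by
        rw [norm_mul, norm_inv, hcn, inv_mul_le_iff₀ (by positivity), mul_one]
        exact hx
      obtain ⟨z, hz⟩ : ∃ z : ℤ_[p], (z : ℚ_[p]) = c⁻¹ * x := ⟨⟨_, hy⟩, rfl⟩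
      obtain ⟨n, hn, hmem⟩ := PadicInt.exists_mem_range z
      refine ⟨⟨n, hn⟩, ?_⟩
      have hmem' : ‖z - (n : ℤ_[p])‖ ≤ (p : ℝ)⁻¹ := by
        rw [PadicInt.maximalIdeal_eq_span_p, ← pow_one (p : ℤ_[p]),
          ← PadicInt.norm_le_pow_iff_mem_span_pow] at hmem
        simpa using hmem
      rw [PadicInt.norm_def] at hmem'
      have heq : -(c * (n : ℚ_[p])) + x = c * (c⁻¹ * x - n) := by
        rw [mul_sub, mul_inv_cancel_left₀ hc0, neg_add_eq_sub]
      rw [heq, norm_mul, hcn, hstep]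
      gcongr
      simpa [hz] using hmem'
    · rintro ⟨i, hi⟩
      have h1 : ‖c * ((i : ℕ) : ℚ_[p])‖ ≤ (p : ℝ) ^ (m + 1) := by
        rw [norm_mul, hcn]
        exact mul_le_of_le_one_right (by positivity)
          (by exact_mod_cast Padic.norm_int_le_one (i : ℤ))
      have h2 : (p : ℝ) ^ m ≤ (p : ℝ) ^ (m + 1) := by
        gcongr
        · exact_mod_cast (Fact.out : p.Prime).one_lt.le
        · omega
      calc ‖x‖ = ‖c * ((i : ℕ) : ℚ_[p]) + (-(c * (i : ℕ)) + x)‖ := by congr 1; ring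
        _ ≤ max _ _ := Padic.nonarchimedean _ _
        _ ≤ _ := max_le h1 (hi.trans h2)
  have hdisj : Pairwise (Function.onFun Disjoint fun i : Fin p =>
      (fun x => -(c * (i : ℕ)) + x) ⁻¹' {x : ℚ_[p] | ‖x‖ ≤ (p : ℝ) ^ m}) := by
    intro i j hij
    rw [Function.onFun, Set.disjoint_left]
    intro x hxi hxj
    simp only [Set.mem_ofPred_eq, Set.mem_preimage] at hxi hxj
    have h1 : ‖c * (((i : ℤ) - (j : ℤ) : ℤ) : ℚ_[p])‖ ≤ (p : ℝ) ^ m := by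
      have := Padic.nonarchimedean (-(c * ((j : ℕ) : ℚ_[p])) + x)
        (-(-(c * ((i : ℕ) : ℚ_[p])) + x))
      rw [norm_neg] at this
      refine le_trans (le_of_eq ?_) (this.trans (max_le hxj hxi))
      congr 1; push_cast; ring
    rw [norm_mul, hcn, hstep] at h1
    have h2 := le_of_mul_le_mul_left h1 (by positivity)
    have h3 : ‖(((i : ℤ) - (j : ℤ) : ℤ) : ℚ_[p])‖ < 1 :=
      h2.trans_lt (inv_lt_one_of_one_lt₀ (by exact_mod_cast (Fact.out : p.Prime).one_lt))
    rw [Padic.norm_intCast_lt_one_iff] at h3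
    have h4 : ((i : ℤ) - j) = 0 := Int.eq_zero_of_abs_lt_dvd h3 (by
      rw [abs_lt]; constructor <;> omega)
    exact hij (Fin.ext (by omega))
  have hmeas : MeasurableSet {x : ℚ_[p] | ‖x‖ ≤ (p : ℝ) ^ m} :=
    measurableSet_le measurable_norm measurable_const
  rw [hunion, measure_iUnion hdisj fun i => hmeas.preimage (measurable_const_add _)]
  simp only [measure_preimage_add, tsum_fintype, Finset.sum_const, Finset.card_univ,
    Fintype.card_fin, nsmul_eq_mul]

lemma Padic.measureReal_closedBall (p : ℕ) [Fact p.Prime]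
    [MeasurableSpace ℚ_[p]] [BorelSpace ℚ_[p]] (μ : Measure ℚ_[p]) [μ.IsAddHaarMeasure]
    (hμ : μ {x : ℚ_[p] | ‖x‖ ≤ 1} = 1) (m : ℤ) :
    μ.real {x : ℚ_[p] | ‖x‖ ≤ (p : ℝ) ^ m} = (p : ℝ) ^ m := by
  have hp : (p : ℝ) ≠ 0 := by exact_mod_cast (Fact.out : p.Prime).ne_zero
  have hstep (m : ℤ) : μ.real {x : ℚ_[p] | ‖x‖ ≤ (p : ℝ) ^ (m + 1)} =
      p * μ.real {x : ℚ_[p] | ‖x‖ ≤ (p : ℝ) ^ m} := by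
    simp [Measure.real, Padic.measure_closedBall_succ]
  induction m with
  | zero => simp [Measure.real, hμ]
  | succ n ih => rw [hstep, ih, zpow_add_one₀ hp, mul_comm]
  | pred n ih =>
    have h := hstep (-(n : ℤ) - 1)
    rw [sub_add_cancel, ih] at h
    refine Eq.trans ?_ (zpow_sub_one₀ hp _).symm
    exact (eq_mul_inv_iff_mul_eq₀ hp).2 ((mul_comm _ _).trans h.symm)

/-- The integral of the fundamental solution over a ball as an exponential series. -/
lemma setIntegral_rho (p : ℕ) [Fact p.Prime]
    [MeasurableSpace ℚ_[p]] [BorelSpace ℚ_[p]] (μ : Measure ℚ_[p]) [μ.IsAddHaarMeasure]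
    (hμ : μ {x : ℚ_[p] | ‖x‖ ≤ 1} = 1) {σ b t : ℝ} (hσ : 0 < σ) (hb : 0 < b) (ht : 0 < t)
    (a : ℤ) :
    ∫ x in {x : ℚ_[p] | ‖x‖ ≤ (p : ℝ) ^ a}, rho p σ b t x ∂μ =
      Real.exp (-(σ * (p : ℝ) ^ (-((a : ℝ) * b)) * t)) + ∑' k : ℕ,
        (Real.exp (-(σ * (p : ℝ) ^ (-((a : ℝ) * b)) * t * ((p : ℝ) ^ b)⁻¹ ^ (k + 1))) -
          Real.exp (-(σ * (p : ℝ) ^ (-((a : ℝ) * b)) * t * ((p : ℝ) ^ b)⁻¹ ^ k))) *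
          (p : ℝ)⁻¹ ^ (k + 1) := by
  have hp1 : (1 : ℝ) < p := by exact_mod_cast (Fact.out : p.Prime).one_lt
  have hp : (0 : ℝ) < p := by linarith
  have hpow (n : ℤ) : σ * t * (p : ℝ) ^ (((n - a : ℤ) : ℝ) * b) =
      σ * (p : ℝ) ^ (-((a : ℝ) * b)) * t * ((p : ℝ) ^ b) ^ n := by
    rw [← Real.rpow_intCast ((p : ℝ) ^ b), ← Real.rpow_mul hp.le]
    have : (p : ℝ) ^ (((n - a : ℤ) : ℝ) * b) =
        (p : ℝ) ^ (-((a : ℝ) * b)) * (p : ℝ) ^ (b * n) := by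
      rw [← Real.rpow_add hp]; congr 1; push_cast; ring
    rw [this]; ring
  set F : ℤ → ℚ_[p] → ℝ := fun r x =>
    (Real.exp (-(σ * t * (p : ℝ) ^ ((r : ℝ) * b))) -
      Real.exp (-(σ * t * (p : ℝ) ^ (((r : ℝ) + 1) * b)))) *
    (p : ℝ) ^ (r : ℤ) *
    Set.indicator {y : ℚ_[p] | ‖y‖ ≤ (p : ℝ) ^ (-r : ℤ)} (fun _ => 1) x with hF
  have hmeas (m : ℤ) : MeasurableSet {x : ℚ_[p] | ‖x‖ ≤ (p : ℝ) ^ m} :=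
    measurableSet_le measurable_norm measurable_const
  have hfin (m : ℤ) : μ {x : ℚ_[p] | ‖x‖ ≤ (p : ℝ) ^ m} ≠ ⊤ := by
    intro h
    have h1 := Padic.measureReal_closedBall p μ hμ m
    rw [Measure.real, h, ENNReal.toReal_top] at h1
    exact (zpow_pos hp m).ne h1
  have hintegrable (r : ℤ) : Integrable (F r) (μ.restrict {x : ℚ_[p] | ‖x‖ ≤ (p : ℝ) ^ a}) := by
    refine Integrable.const_mul ?_ _
    refine (integrable_indicator_iff (hmeas _)).2 ?_
    exact integrableOn_const ((Measure.restrict_apply_le _ _).trans_lt (hfin _).lt_top).ne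
  have hnonneg (r : ℤ) (x : ℚ_[p]) : 0 ≤ F r x := by
    refine mul_nonneg (mul_nonneg (sub_nonneg.2 (Real.exp_le_exp.2 (neg_le_neg ?_)))
      (zpow_pos hp r).le) (Set.indicator_nonneg (fun _ _ => zero_le_one) _)
    gcongr
    · exact hp1.le
    · linarith
  have hval (n : ℤ) : ∫ x in {x : ℚ_[p] | ‖x‖ ≤ (p : ℝ) ^ a}, F (n - a) x ∂μ =
      (Real.exp (-(σ * (p : ℝ) ^ (-((a : ℝ) * b)) * t * ((p : ℝ) ^ b) ^ n)) -
        Real.exp (-(σ * (p : ℝ) ^ (-((a : ℝ) * b)) * t * ((p : ℝ) ^ b) ^ (n + 1)))) *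
        (p : ℝ) ^ (min 0 n) := by
    have hinter : {x : ℚ_[p] | ‖x‖ ≤ (p : ℝ) ^ (-(n - a))} ∩ {x : ℚ_[p] | ‖x‖ ≤ (p : ℝ) ^ a} =
        {x : ℚ_[p] | ‖x‖ ≤ (p : ℝ) ^ (min 0 n - (n - a))} := by
      have hmono : Monotone fun k : ℤ => (p : ℝ) ^ k := (zpow_right_strictMono₀ hp1).monotone
      ext x
      rw [show min 0 n - (n - a) = min (-(n - a)) a by omega, Set.mem_inter_iff,
        Set.mem_ofPred_eq, Set.mem_ofPred_eq, Set.mem_ofPred_eq, hmono.map_min, le_min_iff]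
    have hone : (((n - a : ℤ) : ℝ) + 1) = ((n + 1 - a : ℤ) : ℝ) := by push_cast; ring
    simp only [hF]
    rw [integral_const_mul, integral_indicator_const _ (hmeas _),
      measureReal_restrict_apply (hmeas _), hinter, Padic.measureReal_closedBall p μ hμ, hone,
      hpow, hpow, smul_eq_mul, mul_one, mul_assoc, ← zpow_add₀ hp.ne', add_sub_cancel]
  have hsum := hasSum_int_exp_sub_exp (s := σ * (p : ℝ) ^ (-((a : ℝ) * b)) * t)
    (by positivity) (Real.one_lt_rpow hp1 hb) hp1
  simp only [← hval] at hsum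
  have hsum' := (Equiv.subRight a).hasSum_iff
    (f := fun r => ∫ x in {x : ℚ_[p] | ‖x‖ ≤ (p : ℝ) ^ a}, F r x ∂μ) |>.1 hsum
  have hI := hasSum_integral_of_summable_integral_norm hintegrable (by
    simpa only [Real.norm_of_nonneg (hnonneg _ _)] using hsum'.summable)
  exact hI.unique hsum'

/-- Fix an integer `a` and let `B(t) = ∫_{B_a} ρ(t,x) dμ(x)` for `t > 0`
(with `B(0) = 1`).  Then `B` has right-derivative `−σ·α·p^{−ab}` at `0`, i.e.
`lim_{t→0+} (B(t) − 1)/t = −σ·α·p^{−ab}`, where `α = 1 − (p^b − 1)/(p^{b+1} − 1)`. -/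
theorem exit_prob_statement_9 (p : ℕ) [Fact p.Prime]
    [MeasurableSpace ℚ_[p]] [BorelSpace ℚ_[p]]
    (μ : Measure ℚ_[p]) [μ.IsAddHaarMeasure]
    (hμ : μ {x : ℚ_[p] | ‖x‖ ≤ 1} = 1)
    (σ b : ℝ) (hσ : 0 < σ) (hb : 0 < b) (a : ℤ) :
    Tendsto
      (fun t : ℝ => ((∫ x in {x : ℚ_[p] | ‖x‖ ≤ (p : ℝ) ^ a}, rho p σ b t x ∂μ) - 1) / t)
      (nhdsWithin 0 (Set.Ioi 0))
      (nhds (-(σ * (1 - ((p : ℝ) ^ b - 1) / ((p : ℝ) ^ (b + 1) - 1)) *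
        (p : ℝ) ^ (-((a : ℝ) * b))))) := by
  have hp1 : (1 : ℝ) < p := by exact_mod_cast (Fact.out : p.Prime).one_lt
  have hp : (0 : ℝ) < p := by linarith
  have hu := Real.one_lt_rpow hp1 hb
  have h := tendsto_expSeries_sub_one_div (C := σ * (p : ℝ) ^ (-((a : ℝ) * b)))
    (v := ((p : ℝ) ^ b)⁻¹) (q := (p : ℝ)⁻¹) (by positivity) (by positivity)
    (inv_lt_one_of_one_lt₀ hu) (by positivity) (inv_lt_one_of_one_lt₀ hp1)
  have hα : (p : ℝ)⁻¹ * (1 - ((p : ℝ) ^ b)⁻¹) / (1 - (p : ℝ)⁻¹ * ((p : ℝ) ^ b)⁻¹) =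
      ((p : ℝ) ^ b - 1) / ((p : ℝ) ^ (b + 1) - 1) := by
    rw [Real.rpow_add_one hp.ne']
    have h1 : (p : ℝ) ^ b * p - 1 ≠ 0 := by nlinarith
    have h2 : 1 - (p : ℝ)⁻¹ * ((p : ℝ) ^ b)⁻¹ ≠ 0 := by
      rw [← mul_inv]
      exact (sub_pos.2 (inv_lt_one_of_one_lt₀ (by nlinarith))).ne'
    rw [div_eq_div_iff h2 h1]
    field_simp
  rw [hα, mul_right_comm] at h
  refine h.congr' ?_
  filter_upwards [self_mem_nhdsWithin] with t ht
  rw [setIntegral_rho p μ hμ hσ hb ht]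
end

section
/- For every integer a, every natural number n ≥ 1, and all positive real numbers s_1, …, s_n, the iterated integral of the product of transition densities over the ball factorizes: with x_0 := 0, ∫_{B_a} ⋯ ∫_{B_a} ∏_{j=1}^n ρ(s_j, x_j − x_{j−1}) dμ(x_n) ⋯ dμ(x_1) = ∏_{j=1}^n ∫_{B_a} ρ(s_j, x) dμ(x). -/
open MeasureTheory

/-- The iterated integral `∫_A ρ(t_1, x_1−x_0) ∫_A ρ(t_2, x_2−x_1) ⋯ ∫_A ρ(t_k, x_k−x_{k−1})
· f(x_k) dμ(x_k) ⋯ dμ(x_1)`, defined by recursion on the list `(t_1,…,t_k)` of time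
increments; `f` is the innermost factor and `x0` the starting point. -/
noncomputable def iterInt (p : ℕ) [Fact p.Prime] [MeasurableSpace ℚ_[p]]
    (σ b : ℝ) (μ : MeasureTheory.Measure ℚ_[p]) (A : Set ℚ_[p]) (f : ℚ_[p] → ℝ) :
    List ℝ → ℚ_[p] → ℝ
  | [], x0 => f x0
  | t :: ts, x0 => ∫ x in A, rho p σ b t (x - x0) * iterInt p σ b μ A f ts x ∂μ

/-- The integral of a function over a ball centred at `0` is unchanged when the function is
translated by an element of the ball. -/
theorem setIntegral_sub_eq_of_mem_ball (p : ℕ) [Fact p.Prime]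
    [MeasurableSpace ℚ_[p]] [BorelSpace ℚ_[p]]
    (μ : Measure ℚ_[p]) [μ.IsAddRightInvariant]
    (R : ℝ) (g : ℚ_[p] → ℝ) (x0 : ℚ_[p]) (hx0 : ‖x0‖ ≤ R) :
    ∫ x in {x : ℚ_[p] | ‖x‖ ≤ R}, g (x - x0) ∂μ = ∫ x in {x : ℚ_[p] | ‖x‖ ≤ R}, g x ∂μ := by
  have hA : MeasurableSet {x : ℚ_[p] | ‖x‖ ≤ R} :=
    (isClosed_le continuous_norm continuous_const).measurableSet
  have hmem (x : ℚ_[p]) : ‖x - x0‖ ≤ R ↔ ‖x‖ ≤ R := by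
    refine ⟨fun h => ?_, fun h => ?_⟩
    · simpa using (Padic.nonarchimedean (x - x0) x0).trans (max_le h hx0)
    · simpa [sub_eq_add_neg] using
        (Padic.nonarchimedean x (-x0)).trans (max_le h (by simpa using hx0))
  rw [← integral_indicator hA, ← integral_indicator hA,
    ← integral_sub_right_eq_self ({x : ℚ_[p] | ‖x‖ ≤ R}.indicator g) x0]
  refine integral_congr_ae (.of_forall fun x => ?_)
  simp only [Set.indicator_apply, Set.mem_ofPred_eq, hmem]

/-- Over a ball centred at `0`, the iterated integral started inside the ball factorizes. -/
theorem iterInt_ball_eq_prod (p : ℕ) [Fact p.Prime]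
    [MeasurableSpace ℚ_[p]] [BorelSpace ℚ_[p]]
    (μ : Measure ℚ_[p]) [μ.IsAddRightInvariant]
    (σ b R : ℝ) (l : List ℝ) (x0 : ℚ_[p]) (hx0 : ‖x0‖ ≤ R) :
    iterInt p σ b μ {x : ℚ_[p] | ‖x‖ ≤ R} (fun _ => 1) l x0 =
      (l.map fun t => ∫ x in {x : ℚ_[p] | ‖x‖ ≤ R}, rho p σ b t x ∂μ).prod := by
  have hA : MeasurableSet {x : ℚ_[p] | ‖x‖ ≤ R} :=
    (isClosed_le continuous_norm continuous_const).measurableSet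
  induction l generalizing x0 with
  | nil => simp [iterInt]
  | cons t ts ih =>
    rw [iterInt, List.map_cons, List.prod_cons,
      ← setIntegral_sub_eq_of_mem_ball p μ R (rho p σ b t) x0 hx0, ← integral_mul_const]
    exact setIntegral_congr_fun hA fun x hx => by simp only [ih x hx]

/-- For every integer `a`, every `n ≥ 1`, and all positive reals
`s_1,…,s_n`, the iterated integral over the ball `B_a` of the product of transition
densities factorizes (with `x_0 := 0`):
`∫_{B_a}⋯∫_{B_a} ∏_{j=1}^n ρ(s_j, x_j − x_{j−1}) dμ(x_n)⋯dμ(x_1)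
  = ∏_{j=1}^n ∫_{B_a} ρ(s_j, x) dμ(x)`. -/
theorem exit_prob_statement_11 (p : ℕ) [Fact p.Prime]
    [MeasurableSpace ℚ_[p]] [BorelSpace ℚ_[p]]
    (μ : Measure ℚ_[p]) [μ.IsAddHaarMeasure]
    (hμ : μ {x : ℚ_[p] | ‖x‖ ≤ 1} = 1)
    (σ b : ℝ) (hσ : 0 < σ) (hb : 0 < b)
    (a : ℤ) (n : ℕ) (hn : 1 ≤ n) (s : Fin n → ℝ) (hs : ∀ j, 0 < s j) :
    iterInt p σ b μ {x : ℚ_[p] | ‖x‖ ≤ (p : ℝ) ^ a} (fun _ => 1) (List.ofFn s) 0 =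
      ∏ j : Fin n, ∫ x in {x : ℚ_[p] | ‖x‖ ≤ (p : ℝ) ^ a}, rho p σ b (s j) x ∂μ := by
  rw [iterInt_ball_eq_prod p μ σ b _ _ 0 (by rw [norm_zero]; positivity), List.map_ofFn,
    List.prod_ofFn]
  rfl
end
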